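/- arXiv:2405.19965 — 2 statements merged into one kernel-verified Lean document; each statement's English description precedes it below -/
import Mathlib

section
/- Let q ≥ 3 be a power of an odd prime, let m > 2 be even, n = (q^m−1)/2, and let b be an integer with 1 ≤ b ≤ q−1. Set δ″ = b(q^m−1)/(q^2−1) and δ = ⌈(δ″+1)/2⌉. Then the negacyclic BCH code C_{(n,−1,δ,0)} over F_q has length n, minimum distance at least δ, and dimension k = Σ_{t=0}^{m/2} (m/(m−t)) binom(m−t, t) Σ_{j=0}^{t} binom(t, j) ⌊(q−b)/2⌋^j ⌈(q−b)/2⌉^{t−j} φ(t,j), where φ(t,j) = Σ_{i=0}^{m/2−t} binom(m−2t, 2i) ⌈(q−2)/2⌉^{2i} ⌊q/2⌋^{m−2t−2i} if j is odd, and φ(t,j) = Σ_{i=0}^{m/2−t−1} binom(m−2t, 2i+1) ⌈(q−2)/2⌉^{2i+1} ⌊q/2⌋^{m−2t−2i−1} if j is even. -/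
open Finset

/-- The `q`-cyclotomic coset of `i` modulo `N`, as a subset of `ZMod N`. -/
def qCoset (q N i : ℕ) : Set (ZMod N) :=
  Set.range fun j : ℕ => (i : ZMod N) * (q : ZMod N) ^ j

/-- The odd `q`-cyclotomic coset leaders modulo `N`. -/
noncomputable def oddLeaders (q N : ℕ) : Finset ℕ := by
  classical
  exact (Finset.range N).filter fun s => Odd s ∧ ∀ j : ℕ, s ≤ (s * q ^ j) % N

/-- `x` is the `i`-th largest element of the finite set `S` (1-indexed). -/
def IsIthLargest (S : Finset ℕ) (i x : ℕ) : Prop :=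
  x ∈ S ∧ (S.filter fun y => x ≤ y).card = i

/-- Evaluation of the polynomial with coefficient vector `c` at the point `x`
of an extension field. -/
noncomputable def evalAt (F : Type*) {E : Type*} [Field F] [Field E] [Algebra F E]
    (n : ℕ) (x : E) : (Fin n → F) →ₗ[F] E where
  toFun c := ∑ j : Fin n, c j • x ^ (j : ℕ)
  map_add' a b := by simp [add_smul, Finset.sum_add_distrib]
  map_smul' r a := by simp [Finset.smul_sum, smul_smul]

/-- The negacyclic BCH code `C_(n,-1,δ,b)`: all words whose polynomial vanishes at
`γ^(1+2i)` for `b ≤ i ≤ b+δ-2`, where `γ` is a primitive `2n`-th root of unity. -/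
noncomputable def negaBCH (F : Type*) {E : Type*} [Field F] [Field E] [Algebra F E]
    (n : ℕ) (γ : E) (δ b : ℕ) : Submodule F (Fin n → F) :=
  ⨅ i ∈ Finset.Icc b (b + δ - 2), LinearMap.ker (evalAt F n (γ ^ (1 + 2 * i)))

/-- The cyclic BCH code `C_(n,1,δ,b)`: all words whose polynomial vanishes at
`β^i` for `b ≤ i ≤ b+δ-2`, where `β` is a primitive `n`-th root of unity. -/
noncomputable def cyclicBCH (F : Type*) {E : Type*} [Field F] [Field E] [Algebra F E]
    (n : ℕ) (β : E) (δ b : ℕ) : Submodule F (Fin n → F) :=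
  ⨅ i ∈ Finset.Icc b (b + δ - 2), LinearMap.ker (evalAt F n (β ^ i))

/-- The dual code under the standard inner product. -/
def dualCode {F : Type*} [Field F] {n : ℕ} (C : Submodule F (Fin n → F)) :
    Submodule F (Fin n → F) where
  carrier := {y | ∀ c ∈ C, ∑ j, y j * c j = 0}
  add_mem' := by
    intro a b ha hb c hc
    simp only [Set.mem_setOf_eq] at *
    simp [Pi.add_apply, add_mul, Finset.sum_add_distrib, ha c hc, hb c hc]
  zero_mem' := by intro c hc; simp
  smul_mem' := by
    intro r y hy c hc
    simp only [Set.mem_setOf_eq] at *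
    simp [Pi.smul_apply, smul_eq_mul, mul_assoc, ← Finset.mul_sum, hy c hc]

/-- The extended code of a code of length `n`. -/
def extendedCode {F : Type*} [Field F] {n : ℕ} (C : Submodule F (Fin n → F)) :
    Submodule F (Fin (n + 1) → F) where
  carrier := {x | (fun j : Fin n => x j.castSucc) ∈ C ∧ ∑ i, x i = 0}
  add_mem' := by
    intro a b ha hb
    exact ⟨C.add_mem ha.1 hb.1, by simp [Finset.sum_add_distrib, ha.2, hb.2]⟩
  zero_mem' := ⟨C.zero_mem, by simp⟩
  smul_mem' := by
    intro r x hx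
    exact ⟨C.smul_mem r hx.1, by simp [← Finset.mul_sum, hx.2]⟩

/-- Hamming weight of a word. -/
noncomputable def hWt {F : Type*} [Field F] {n : ℕ} (c : Fin n → F) : ℕ := by
  classical exact hammingNorm c

/-- `d` is the minimum Hamming distance of the code `C`. -/
def minDistIs {F : Type*} [Field F] {n : ℕ} (C : Submodule F (Fin n → F)) (d : ℕ) : Prop :=
  IsLeast {w : ℕ | ∃ c ∈ C, c ≠ 0 ∧ hWt c = w} d

/-! ### Codes defined by a set of zeros -/

section ZeroSets

open Polynomial

variable {F E : Type*} [Field F] [Field E] [Algebra F E]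

/-- The polynomial of degree less than `n` with coefficient vector `c`. -/
noncomputable def wordPoly {n : ℕ} (c : Fin n → F) : F[X] :=
  ((degreeLTEquiv F n).symm c : F[X])

lemma aeval_wordPoly {n : ℕ} (c : Fin n → F) (x : E) :
    aeval x (wordPoly c) = evalAt F n x c := by
  simp [wordPoly, degreeLTEquiv, evalAt, Algebra.smul_def, aeval_monomial]

lemma evalAt_pow_card [Fintype F] {n : ℕ} (c : Fin n → F) (x : E) :
    evalAt F n (x ^ Fintype.card F) c = evalAt F n x c ^ Fintype.card F := by
  rw [← aeval_wordPoly, ← aeval_wordPoly, ← FiniteField.frobeniusAlgHom_apply F E,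
    ← FiniteField.frobeniusAlgHom_apply F E, aeval_algHom_apply]

lemma evalAt_pow_card_pow [Fintype F] {n : ℕ} (c : Fin n → F) (x : E) (j : ℕ) :
    evalAt F n (x ^ Fintype.card F ^ j) c = evalAt F n x c ^ Fintype.card F ^ j := by
  induction j with
  | zero => simp
  | succ j ih => rw [pow_succ, pow_mul, evalAt_pow_card, ih, ← pow_mul]

/-- An element fixed by the Frobenius of the finite base field lies in the base field. -/
lemma mem_range_algebraMap_of_pow_card_eq [Fintype F] {x : E} (hx : x ^ Fintype.card F = x) :
    x ∈ Set.range (algebraMap F E) := by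
  classical
  by_contra hnot
  have hq := Fintype.one_lt_card (α := F)
  have hne : (X ^ Fintype.card F - X : E[X]) ≠ 0 := FiniteField.X_pow_card_sub_X_ne_zero E hq
  have hsub : (insert x (Finset.univ.image (algebraMap F E))).val ⊆
      (X ^ Fintype.card F - X : E[X]).roots := by
    intro y hy
    rw [mem_roots hne, IsRoot.def, eval_sub, eval_pow, eval_X, sub_eq_zero]
    rcases Finset.mem_insert.mp hy with rfl | hy
    · exact hx
    · obtain ⟨a, -, rfl⟩ := Finset.mem_image.mp hy
      rw [← map_pow, FiniteField.pow_card]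
  have hle := card_le_degree_of_subset_roots hsub
  rw [FiniteField.X_pow_card_sub_X_natDegree_eq E hq, Finset.card_insert_of_notMem
    (by simpa using hnot), Finset.card_image_of_injective _ (algebraMap F E).injective,
    Finset.card_univ] at hle
  omega

/-- A finite set of roots stable under the Frobenius is the zero set of a polynomial over the
base field. -/
lemma exists_map_eq_prod_X_sub_C [Fintype F] (T : Finset E)
    (hT : ∀ x ∈ T, x ^ Fintype.card F ∈ T) :
    ∃ g : F[X], g.map (algebraMap F E) = ∏ x ∈ T, (X - C x) := by
  classical
  rw [← mem_lifts, lifts_iff_coeff_lifts]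
  intro k
  apply mem_range_algebraMap_of_pow_card_eq
  have hinj : Function.Injective fun x : E => x ^ Fintype.card F :=
    (FiniteField.frobeniusAlgHom F E).toRingHom.injective
  have himg : T.image (fun x => x ^ Fintype.card F) = T := by
    apply Finset.eq_of_subset_of_card_le
    · intro y hy
      obtain ⟨x, hx, rfl⟩ := Finset.mem_image.mp hy
      exact hT x hx
    · rw [Finset.card_image_of_injective _ hinj]
  have hmap : (∏ x ∈ T, (X - C x)).map (FiniteField.frobeniusAlgHom F E).toRingHom
      = ∏ x ∈ T, (X - C x) := by
    conv_rhs => rw [← himg, Finset.prod_image (fun _ _ _ _ h => hinj h)]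
    simp [Polynomial.map_prod]
  conv_rhs => rw [← hmap, coeff_map]
  rfl

/-- The words whose polynomial vanishes on a Frobenius-stable set `T` form a code of
codimension `|T|`. -/
lemma finrank_iInf_ker_evalAt [Fintype F] {n : ℕ} (T : Finset E)
    (hT : ∀ x ∈ T, x ^ Fintype.card F ∈ T) (hn : T.card ≤ n) :
    Module.finrank F (⨅ x ∈ T, LinearMap.ker (evalAt F n x) : Submodule F (Fin n → F))
      = n - T.card := by
  obtain ⟨g, hg⟩ := exists_map_eq_prod_X_sub_C T hT
  have hmonic : g.Monic := by
    apply monic_of_injective (algebraMap F E).injective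
    rw [hg]
    exact monic_prod_X_sub_C _ _
  have hdeg : g.natDegree = T.card := by
    rw [← natDegree_map_eq_of_injective (algebraMap F E).injective g, hg]
    exact natDegree_finsetProd_X_sub_C_eq_card T id
  have hdvd : ∀ p : F[X], g ∣ p ↔ ∀ x ∈ T, aeval x p = 0 := by
    intro p
    rw [← map_dvd_map' (algebraMap F E), hg]
    constructor
    · intro h x hx
      have := (Finset.dvd_prod_of_mem (fun x => X - C x) hx).trans h
      rwa [dvd_iff_isRoot, IsRoot.def, eval_map_algebraMap] at this
    · intro h
      apply Finset.prod_dvd_of_coprime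
      · intro x _ y _ hxy
        exact pairwise_coprime_X_sub_C Function.injective_id hxy
      · intro x hx
        rw [dvd_iff_isRoot, IsRoot.def, eval_map_algebraMap]
        exact h x hx
  have hmem : ∀ h : degreeLT F (n - T.card), g * (h : F[X]) ∈ degreeLT F n := by
    intro h
    rw [mem_degreeLT]
    by_cases h0 : (h : F[X]) = 0
    · simp [h0]
    · have h1 := mem_degreeLT.mp h.2
      rw [degree_eq_natDegree h0, Nat.cast_lt] at h1
      rw [degree_eq_natDegree (mul_ne_zero hmonic.ne_zero h0), Nat.cast_lt,
        natDegree_mul hmonic.ne_zero h0, hdeg]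
      omega
  let ψ : degreeLT F (n - T.card) →ₗ[F] degreeLT F n :=
    ((LinearMap.mulLeft F g).comp (degreeLT F (n - T.card)).subtype).codRestrict _ hmem
  let Ψ := (degreeLTEquiv F n).toLinearMap.comp ψ
  have hΨ : Function.Injective Ψ := by
    refine (degreeLTEquiv F n).injective.comp fun a b hab => ?_
    have : g * (a : F[X]) = g * b := congrArg Subtype.val hab
    exact Subtype.ext (mul_left_cancel₀ hmonic.ne_zero this)
  have hrange : LinearMap.range Ψ = ⨅ x ∈ T, LinearMap.ker (evalAt F n x) := by
    ext c
    simp only [Submodule.mem_iInf, LinearMap.mem_ker, ← aeval_wordPoly]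
    rw [← hdvd, LinearMap.mem_range]
    constructor
    · rintro ⟨h, rfl⟩
      simp only [Ψ, wordPoly, LinearMap.comp_apply, LinearEquiv.coe_coe,
        LinearEquiv.symm_apply_apply]
      exact Dvd.intro _ rfl
    · rintro ⟨h, hh⟩
      have hlt : h ∈ degreeLT F (n - T.card) := by
        rw [mem_degreeLT]
        by_cases h0 : h = 0
        · simp [h0]
        · have h1 := mem_degreeLT.mp ((degreeLTEquiv F n).symm c).2
          rw [show ((degreeLTEquiv F n).symm c : F[X]) = g * h from hh,
            degree_eq_natDegree (mul_ne_zero hmonic.ne_zero h0), Nat.cast_lt,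
            natDegree_mul hmonic.ne_zero h0, hdeg] at h1
          rw [degree_eq_natDegree h0, Nat.cast_lt]
          omega
      refine ⟨⟨h, hlt⟩, ?_⟩
      simp only [Ψ, LinearMap.comp_apply, LinearEquiv.coe_coe]
      rw [← LinearEquiv.eq_symm_apply]
      exact Subtype.ext hh.symm
  rw [← hrange, LinearMap.finrank_range_of_inj hΨ, (degreeLTEquiv F (n - T.card)).finrank_eq]
  simp

/-- The BCH bound: a nonzero word vanishing at `γ, γ³, …, γ^(2δ-3)` has weight at least `δ`. -/
lemma le_hWt_of_mem_negaBCH {n δ : ℕ} {γ : E} (hγ : IsPrimitiveRoot γ (2 * n))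
    {c : Fin n → F} (hc : c ∈ negaBCH F n γ δ 0) (hc0 : c ≠ 0) : δ ≤ hWt c := by
  classical
  by_contra! hlt
  obtain ⟨j₀, hj₀⟩ : ∃ j, c j ≠ 0 := Function.ne_iff.mp hc0
  set S : Finset (Fin n) := Finset.univ.filter fun j => c j ≠ 0 with hS
  have hwt : S.card = hWt c := by
    simp only [hWt, hammingNorm, hS]
  have hjS : j₀ ∈ S := by simp [hS, hj₀]
  have hSpos : 0 < S.card := Finset.card_pos.mpr ⟨j₀, hjS⟩
  have hvan : ∀ i, i + 2 ≤ δ → ∑ j, algebraMap F E (c j) * γ ^ (j : ℕ) * (γ ^ (2 * (j : ℕ))) ^ i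
      = 0 := by
    intro i hi
    simp only [negaBCH, Submodule.mem_iInf, LinearMap.mem_ker] at hc
    have := hc i (by simp; omega)
    rw [← this]
    simp only [evalAt, LinearMap.coe_mk, AddHom.coe_mk, Algebra.smul_def]
    refine Finset.sum_congr rfl fun j _ => ?_
    ring
  have hpoly : ∀ p : E[X], p.natDegree + 2 ≤ δ →
      ∑ j, algebraMap F E (c j) * γ ^ (j : ℕ) * p.eval (γ ^ (2 * (j : ℕ))) = 0 := by
    intro p hp
    simp only [eval_eq_sum_range, Finset.mul_sum]
    rw [Finset.sum_comm]
    refine Finset.sum_eq_zero fun i hi => ?_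
    have h := hvan i (by have := Finset.mem_range.mp hi; omega)
    rw [← mul_zero (p.coeff i), ← h, Finset.mul_sum]
    refine Finset.sum_congr rfl fun j _ => ?_
    ring
  set p : E[X] := ∏ j ∈ S.erase j₀, (X - C (γ ^ (2 * (j : ℕ)))) with hp
  have hdeg : p.natDegree = S.card - 1 := by
    rw [hp, natDegree_finsetProd_X_sub_C_eq_card, Finset.card_erase_of_mem hjS]
  have hsum := hpoly p (by omega)
  rw [Finset.sum_eq_single j₀] at hsum
  · have hn0 : γ ≠ 0 := hγ.ne_zero (by have := j₀.2; omega)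
    have hpj : p.eval (γ ^ (2 * (j₀ : ℕ))) ≠ 0 := by
      rw [hp, eval_prod, Finset.prod_ne_zero_iff]
      intro j hj
      rw [eval_sub, eval_X, eval_C, sub_ne_zero]
      intro h
      have := hγ.pow_inj (by have := j₀.2; omega) (by have := j.2; omega) h
      exact (Finset.mem_erase.mp hj).1 (Fin.ext (by omega))
    simp [hj₀, hn0, hpj] at hsum
  · intro j _ hj
    by_cases hcj : c j = 0
    · simp [hcj]
    · have : p.eval (γ ^ (2 * (j : ℕ))) = 0 := by
        rw [hp, eval_prod]
        exact Finset.prod_eq_zero (Finset.mem_erase.mpr ⟨hj, by simp [hS, hcj]⟩) (by simp)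
      simp [this]
  · simp

open Classical in
/-- The dimension of the negacyclic code `C_(n,-1,δ,0)` is the number of odd residues modulo `2n`
whose cyclotomic coset avoids `1, 3, …, 2δ-3`. -/
lemma finrank_negaBCH_zero [Fintype F] {n m δ D : ℕ} {γ : E} (hγ : IsPrimitiveRoot γ (2 * n))
    (hn : 0 < n) (hm : 0 < m) (hqm : Fintype.card F ^ m ≡ 1 [MOD 2 * n])
    (hodd : Odd (Fintype.card F)) (hD : D ≤ 2 * n) (hδ2 : 2 ≤ δ) (hδ : δ = (D + 2) / 2) :
    Module.finrank F (negaBCH F n γ δ 0) =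
      ((range (2 * n)).filter fun a =>
        Odd a ∧ ∀ j, D ≤ (a * Fintype.card F ^ j) % (2 * n)).card := by
  set q := Fintype.card F with hq
  set A := (range (2 * n)).filter fun a => Odd a ∧ ∃ j, (a * q ^ j) % (2 * n) < D with hA
  have hmod : ∀ a, γ ^ (a % (2 * n)) = γ ^ a := fun a => by
    rw [hγ.eq_orderOf, pow_mod_orderOf]
  have hinj : Set.InjOn (γ ^ ·) (A : Set ℕ) := by
    intro a ha b hb hab
    simp only [hA, coe_filter, mem_range, Set.mem_ofPred_eq] at ha hb
    exact hγ.pow_inj ha.1 hb.1 hab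
  set T := A.image (γ ^ ·) with hT
  have hcard : T.card = A.card := card_image_of_injOn hinj
  have hoddcard : ((range (2 * n)).filter Odd).card = n := by
    have h : ((range (2 * n)).filter Odd) = (range n).image fun i => 2 * i + 1 := by
      ext a
      simp only [mem_filter, mem_range, mem_image]
      constructor
      · rintro ⟨h1, i, rfl⟩
        exact ⟨i, by omega, rfl⟩
      · rintro ⟨i, hi, rfl⟩
        exact ⟨by omega, i, rfl⟩
    rw [h, card_image_of_injective _ (fun a b h => by simpa using h), card_range]
  have hsplit : A.card + ((range (2 * n)).filter fun a =>
        Odd a ∧ ∀ j, D ≤ (a * q ^ j) % (2 * n)).card = n := by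
    have h := card_filter_add_card_filter_not (s := (range (2 * n)).filter Odd)
      (fun a => ∃ j, (a * q ^ j) % (2 * n) < D)
    rw [filter_filter, filter_filter, hoddcard] at h
    simpa only [not_exists, not_lt, hA] using h
  have hstable : ∀ x ∈ T, x ^ q ∈ T := by
    intro x hx
    simp only [hT, hA, mem_image, mem_filter, mem_range] at hx ⊢
    obtain ⟨a, ⟨-, ha1, j, hj⟩, rfl⟩ := hx
    refine ⟨(a * q) % (2 * n), ⟨Nat.mod_lt _ (by omega), ?_, j + (m - 1), ?_⟩, ?_⟩
    · have h := ha1.mul hodd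
      rw [Nat.odd_iff] at h ⊢
      rw [Nat.mod_mul_right_mod, h]
    · have : (a * q % (2 * n)) * q ^ (j + (m - 1)) ≡ a * q ^ j [MOD 2 * n] := by
        calc (a * q % (2 * n)) * q ^ (j + (m - 1))
            ≡ (a * q) * q ^ (j + (m - 1)) [MOD 2 * n] := (Nat.mod_modEq _ _).mul_right _
          _ = (a * q ^ j) * q ^ m := by
            obtain ⟨k, rfl⟩ : ∃ k, m = k + 1 := ⟨m - 1, by omega⟩
            rw [Nat.add_sub_cancel]
            ring
          _ ≡ (a * q ^ j) * 1 [MOD 2 * n] := hqm.mul_left _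
          _ = a * q ^ j := mul_one _
      rw [this]
      exact hj
    · rw [hmod, pow_mul]
  have hcode : negaBCH F n γ δ 0 = ⨅ x ∈ T, LinearMap.ker (evalAt F n x) := by
    ext c
    simp only [negaBCH, Submodule.mem_iInf, LinearMap.mem_ker]
    constructor
    · intro h x hx
      simp only [hT, hA, mem_image, mem_filter, mem_range] at hx
      obtain ⟨a, ⟨-, ha1, j, hj⟩, rfl⟩ := hx
      have hs : Odd ((a * q ^ j) % (2 * n)) := by
        have h := ha1.mul (hodd.pow (n := j))
        rw [Nat.odd_iff] at h ⊢
        rw [Nat.mod_mul_right_mod, h]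
      obtain ⟨i, hi⟩ := hs
      have h0 := h i (by rw [Finset.mem_Icc]; omega)
      rw [add_comm 1, ← hi, hmod, pow_mul, hq, evalAt_pow_card_pow] at h0
      exact eq_zero_of_pow_eq_zero h0
    · intro h i hi
      rw [Finset.mem_Icc] at hi
      apply h
      simp only [hT, hA, mem_image, mem_filter, mem_range]
      refine ⟨1 + 2 * i, ⟨by omega, ⟨i, by omega⟩, 0, ?_⟩, rfl⟩
      rw [pow_zero, mul_one, Nat.mod_eq_of_lt (by omega)]
      omega
  rw [hcode, finrank_iInf_ker_evalAt T hstable (by omega)]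
  omega

end ZeroSets

/-! ### Orbits avoiding an initial interval, in terms of base `q` digits -/

section Digits

/-- In base `q`, every window of two consecutive digits among the lowest `n` digits of `a` has value
at least `b`. -/
def WindowsGE (q b n a : ℕ) : Prop :=
  ∀ i, i + 2 ≤ n → b ≤ a / q ^ i % q ^ 2

lemma windowsGE_of_lt_two {q b n a : ℕ} (hn : n < 2) : WindowsGE q b n a :=
  fun i hi => by omega

/-- The `n`-digit words in base `q` with nonzero last digit and all windows at least `b`. -/
def IsLinearWord (q b n a : ℕ) : Prop :=
  WindowsGE q b n a ∧ (n = 0 ∨ a % q ≠ 0)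

/-- The cyclic version of `WindowsGE` for `m`-digit words. -/
def IsCyclicWord (q b m a : ℕ) : Prop :=
  WindowsGE q b m a ∧ (a % q ≠ 0 ∨ b * q ^ (m - 1) ≤ a)

lemma windowsGE_succ_succ {q b n a d : ℕ} (hd : d < q) :
    WindowsGE q b (n + 2) (q * a + d) ↔ b ≤ q * (a % q) + d ∧ WindowsGE q b (n + 1) a := by
  have h0 : (q * a + d) % q ^ 2 = q * (a % q) + d := by
    have h1 : q * (a % q) + d < q ^ 2 := by
      have := Nat.mod_lt a (show 0 < q by omega)
      nlinarith
    conv_lhs => rw [← Nat.div_add_mod a q]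
    rw [show q * (q * (a / q) + a % q) + d = q * (a % q) + d + q ^ 2 * (a / q) by ring,
      Nat.add_mul_mod_self_left, Nat.mod_eq_of_lt h1]
  have hs : ∀ i, (q * a + d) / q ^ (i + 1) = a / q ^ i := by
    intro i
    rw [pow_succ', ← Nat.div_div_eq_div_mul, Nat.mul_add_div (by omega), Nat.div_eq_of_lt hd,
      add_zero]
  constructor
  · intro h
    refine ⟨?_, fun i hi => ?_⟩
    · simpa [h0] using h 0 (by omega)
    · simpa [hs] using h (i + 1) (by omega)
  · rintro ⟨h1, h2⟩ (_ | i) hi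
    · simpa [h0] using h1
    · simpa [hs] using h2 i (by omega)

lemma isLinearWord_succ_succ {q b n a d : ℕ} (hb : b < q) (hd : d < q) :
    IsLinearWord q b (n + 2) (q * a + d) ↔
      (d ≠ 0 ∧ IsLinearWord q b (n + 1) a) ∨
        (b ≤ d ∧ d ≠ 0 ∧ WindowsGE q b (n + 1) a ∧ a % q = 0) := by
  have h : b ≤ q * (a % q) + d ↔ a % q ≠ 0 ∨ b ≤ d := by
    rcases Nat.eq_zero_or_pos (a % q) with h | h
    · simp [h]
    · have : q ≤ q * (a % q) := Nat.le_mul_of_pos_right q h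
      constructor
      · intro _; left; omega
      · intro _; omega
  simp only [IsLinearWord, windowsGE_succ_succ hd, h, Nat.mul_add_mod, Nat.mod_eq_of_lt hd]
  tauto

lemma windowsGE_succ_mul {q b n a : ℕ} (hb0 : 0 < b) (hb : b < q) (ha : a < q ^ n) :
    WindowsGE q b (n + 1) (q * a) ↔ IsLinearWord q b n a := by
  rcases n with _ | n
  · simp [IsLinearWord, windowsGE_of_lt_two]
  · have h := windowsGE_succ_succ (b := b) (n := n) (a := a) (show 0 < q by omega)
    rw [add_zero] at h
    rw [h, IsLinearWord]
    have : b ≤ q * (a % q) + 0 ↔ a % q ≠ 0 := by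
      rcases Nat.eq_zero_or_pos (a % q) with h | h
      · simp [h]; omega
      · have : q ≤ q * (a % q) := Nat.le_mul_of_pos_right q h
        omega
    rw [this]
    simp [and_comm]

/-- Prepending a nonzero top digit does not affect the windows condition. -/
lemma windowsGE_succ_top {q b n h r : ℕ} (hb : b < q) (hh0 : 0 < h) (hh : h < q)
    (hr : r < q ^ n) : WindowsGE q b (n + 1) (h * q ^ n + r) ↔ WindowsGE q b n r := by
  have hq : 0 < q := by omega
  have hlow : ∀ i, i + 2 ≤ n → (h * q ^ n + r) / q ^ i % q ^ 2 = r / q ^ i % q ^ 2 := by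
    intro i hi
    obtain ⟨k, rfl⟩ := Nat.exists_eq_add_of_le hi
    rw [show h * q ^ (i + 2 + k) + r = q ^ i * (q ^ 2 * (h * q ^ k)) + r by ring,
      Nat.mul_add_div (by positivity), Nat.mul_add_mod]
  constructor
  · intro H i hi
    rw [← hlow i hi]
    exact H i (by omega)
  · intro H i hi
    by_cases h2 : i + 2 ≤ n
    · rw [hlow i h2]
      exact H i h2
    · obtain rfl : n = i + 1 := by omega
      have h3 : r / q ^ i < q := by
        rw [Nat.div_lt_iff_lt_mul (by positivity), ← pow_succ']
        exact hr
      rw [show h * q ^ (i + 1) + r = q ^ i * (h * q) + r by ring,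
        Nat.mul_add_div (by positivity), Nat.mod_eq_of_lt]
      · have : q ≤ h * q := Nat.le_mul_of_pos_left q hh0
        exact (hb.le.trans this).trans (Nat.le_add_right _ _)
      · nlinarith

/-- Multiplication by `q ^ j` modulo `q ^ m - 1` rotates the base `q` digits. -/
lemma mul_pow_mod_pow_sub_one {q m j a : ℕ} (hq : 1 < q) (hj : j ≤ m) (ha : a < q ^ m - 1) :
    a * q ^ j % (q ^ m - 1) = a % q ^ (m - j) * q ^ j + a / q ^ (m - j) := by
  obtain ⟨k, rfl⟩ := Nat.exists_eq_add_of_le hj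
  rw [Nat.add_sub_cancel_left]
  have hpk : 0 < q ^ k := by positivity
  have hpj : 0 < q ^ j := by positivity
  have hmul : q ^ (j + k) = q ^ k * q ^ j := by ring
  have hr := Nat.mod_lt a hpk
  have hd : a / q ^ k < q ^ j := by
    rw [Nat.div_lt_iff_lt_mul hpk]
    have : q ^ j * q ^ k = q ^ (j + k) := by ring
    omega
  have hda := Nat.div_add_mod a (q ^ k)
  generalize a / q ^ k = h at *
  generalize a % q ^ k = r at *
  generalize q ^ (j + k) = P at *
  generalize q ^ k = K at *
  generalize q ^ j = J at *
  have hP : 1 ≤ P := by omega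
  have hexp : a * J = (r * J + h) + (P - 1) * h := by
    obtain ⟨P', rfl⟩ := Nat.exists_eq_add_of_le hP
    rw [Nat.add_sub_cancel_left]
    calc a * J = (K * J) * h + r * J := by rw [← hda]; ring
      _ = _ := by rw [← hmul]; ring
  rw [hexp, Nat.add_mul_mod_self_left, Nat.mod_eq_of_lt]
  have hle : r * J + h ≤ P - 1 := by
    have : r * J + J ≤ K * J := by nlinarith
    omega
  refine lt_of_le_of_ne hle fun heq => ?_
  have hrK : r = K - 1 := by
    by_contra hne
    have : r * J + 2 * J ≤ K * J := by
      have : r + 2 ≤ K := by omega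
      nlinarith
    omega
  have hhJ : h = J - 1 := by
    have : r * J + J = K * J := by
      rw [hrK]
      obtain ⟨K', rfl⟩ := Nat.exists_eq_add_of_le (show 1 ≤ K by omega)
      rw [Nat.add_sub_cancel_left]; ring
    omega
  have : K * (J - 1) + (K - 1) = K * J - 1 := by
    obtain ⟨J', rfl⟩ := Nat.exists_eq_add_of_le (show 1 ≤ J by omega)
    rw [Nat.add_sub_cancel_left, mul_add, mul_one]
    omega
  rw [hrK, hhJ] at hda
  omega

/-- A number is a cyclic word exactly when all of its rotations are at least `b q^(m-2)`. -/
lemma isCyclicWord_iff_forall_le {q b m a : ℕ} (hb : b < q) (hb0 : 0 < b) (hm : 2 ≤ m)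
    (ha : a < q ^ m - 1) :
    IsCyclicWord q b m a ↔ ∀ j, b * q ^ (m - 2) ≤ a * q ^ j % (q ^ m - 1) := by
  have hq : 1 < q := by omega
  have hone : q ^ m % (q ^ m - 1) = 1 % (q ^ m - 1) := by
    have h : 1 + (q ^ m - 1) = q ^ m := by omega
    rw [← Nat.add_mod_right 1, h]
  have hred : (∀ j, b * q ^ (m - 2) ≤ a * q ^ j % (q ^ m - 1)) ↔
      ∀ j < m, b * q ^ (m - 2) ≤ a * q ^ j % (q ^ m - 1) := by
    refine ⟨fun h j _ => h j, fun h j => ?_⟩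
    have h1 : a * q ^ j % (q ^ m - 1) = a * q ^ (j % m) % (q ^ m - 1) := by
      have : a * q ^ j ≡ a * q ^ (j % m) [MOD q ^ m - 1] := by
        conv_lhs => rw [← Nat.mod_add_div j m, pow_add, pow_mul]
        have h2 : (q ^ m) ^ (j / m) ≡ 1 [MOD q ^ m - 1] := by
          simpa using Nat.ModEq.pow (j / m) hone
        simpa using (h2.mul_left (q ^ (j % m))).mul_left a
      exact this
    rw [h1]
    exact h _ (Nat.mod_lt _ (by omega))
  have hwin : ∀ i, i + 2 ≤ m →
      (b ≤ a / q ^ i % q ^ 2 ↔ b * q ^ (m - 2) ≤ a * q ^ (m - 2 - i) % (q ^ m - 1)) := by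
    intro i hi
    rw [mul_pow_mod_pow_sub_one hq (by omega) ha, show m - (m - 2 - i) = i + 2 by omega]
    have h1 : a / q ^ (i + 2) < q ^ (m - 2 - i) := by
      rw [Nat.div_lt_iff_lt_mul (by positivity), ← pow_add, show m - 2 - i + (i + 2) = m by omega]
      omega
    have h2 : b * q ^ (m - 2) = (b * q ^ i) * q ^ (m - 2 - i) := by
      rw [mul_assoc, ← pow_add, show i + (m - 2 - i) = m - 2 by omega]
    have h3 : a / q ^ i % q ^ 2 = a % q ^ (i + 2) / q ^ i := by
      rw [pow_add, Nat.mod_mul_right_div_self]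
    rw [h2, h3, Nat.le_div_iff_mul_le (by positivity)]
    constructor
    · intro h
      exact (Nat.mul_le_mul_right _ h).trans (Nat.le_add_right _ _)
    · intro h
      by_contra! hlt
      have : (a % q ^ (i + 2) + 1) * q ^ (m - 2 - i) ≤ b * q ^ i * q ^ (m - 2 - i) :=
        Nat.mul_le_mul_right _ hlt
      rw [add_mul, one_mul] at this
      omega
  have hlast : (a % q ≠ 0 ∨ b * q ^ (m - 1) ≤ a) ↔
      b * q ^ (m - 2) ≤ a * q ^ (m - 1) % (q ^ m - 1) := by
    rw [mul_pow_mod_pow_sub_one hq (by omega) ha, show m - (m - 1) = 1 by omega, pow_one,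
      show m - 1 = m - 2 + 1 by omega, pow_succ]
    generalize q ^ (m - 2) = Q
    rcases Nat.eq_zero_or_pos (a % q) with h | h
    · rw [h, zero_mul, zero_add, Nat.le_div_iff_mul_le (by omega), mul_assoc]
      simp
    · constructor
      · intro _
        have h1 : b * Q ≤ Q * q := by nlinarith
        have h2 : 1 * (Q * q) ≤ a % q * (Q * q) := Nat.mul_le_mul_right _ h
        exact (h1.trans (by simpa using h2)).trans (Nat.le_add_right _ _)
      · intro _; left; omega
  rw [hred, IsCyclicWord, hlast]
  constructor
  · rintro ⟨h1, h2⟩ j hj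
    by_cases hjm : j = m - 1
    · rw [hjm]; exact h2
    · have h3 := (hwin (m - 2 - j) (by omega)).mp (h1 _ (by omega))
      rwa [show m - 2 - (m - 2 - j) = j by omega] at h3
  · intro h
    exact ⟨fun i hi => (hwin i hi).mpr (h _ (by omega)), h _ (by omega)⟩

/-- For `D = b (q^m - 1) / (q² - 1)`, whose base `q` digits are `0 b 0 b … 0 b`, an orbit under
multiplication by `q` modulo `q^m - 1` is bounded below by `D` as soon as it is bounded below by
`b q^(m-2)`. -/
lemma forall_le_orbit_iff {q b m D a : ℕ} (hq : 1 < q) (hb0 : 0 < b) (hm : 2 ≤ m)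
    (hD : D * q ^ 2 = D + b * (q ^ m - 1)) (hDlt : D < q ^ m - 1) :
    (∀ j, D ≤ a * q ^ j % (q ^ m - 1)) ↔ ∀ j, b * q ^ (m - 2) ≤ a * q ^ j % (q ^ m - 1) := by
  have hpm : q ^ m = q ^ (m - 2) * q ^ 2 := by rw [← pow_add, show m - 2 + 2 = m by omega]
  have hN : 1 ≤ q ^ m := Nat.one_le_pow _ _ (by omega)
  have hq2 : 1 < q ^ 2 := Nat.one_lt_pow (by omega) hq
  have hle : b * q ^ (m - 2) ≤ D := by
    have hbD : b ≤ D := by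
      by_contra! h
      have h1 : q ^ 2 - 1 ≤ q ^ m - 1 :=
        Nat.sub_le_sub_right (Nat.pow_le_pow_right (by omega) hm) 1
      have h2 : D * (q ^ 2 - 1) = b * (q ^ m - 1) := by rw [Nat.mul_sub, mul_one]; omega
      have h3 : D * (q ^ 2 - 1) ≤ D * (q ^ m - 1) := Nat.mul_le_mul_left _ h1
      have h4 : D * (q ^ m - 1) < b * (q ^ m - 1) := Nat.mul_lt_mul_of_pos_right h (by omega)
      omega
    have h1 : b * q ^ m ≤ D * q ^ 2 := by
      have : b * (q ^ m - 1) + b = b * q ^ m := by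
        rw [Nat.mul_sub, mul_one, Nat.sub_add_cancel (Nat.le_mul_of_pos_right _ (by omega))]
      omega
    rw [hpm, ← mul_assoc] at h1
    exact Nat.le_of_mul_le_mul_right h1 (by omega)
  refine ⟨fun h j => hle.trans (h j), fun h => ?_⟩
  have key : ∀ x j, a * q ^ j % (q ^ m - 1) = x → D ≤ x := by
    intro x
    induction x using Nat.strong_induction_on with
    | _ x ih =>
      intro j hx
      by_contra! hlt
      have hxb := h j
      rw [hx] at hxb
      have h1 : b * (q ^ m - 1) < x * q ^ 2 := by
        have h2 : b * q ^ m ≤ x * q ^ 2 := by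
          rw [hpm, ← mul_assoc]
          exact Nat.mul_le_mul_right _ hxb
        have h3 : b * (q ^ m - 1) < b * q ^ m := Nat.mul_lt_mul_of_pos_left (by omega) hb0
        omega
      obtain ⟨y, hy⟩ := Nat.exists_eq_add_of_le h1.le
      have h4 : x * q ^ 2 + q ^ 2 ≤ D * q ^ 2 := by nlinarith
      have hyx : y < x := by
        obtain ⟨z, rfl⟩ := Nat.exists_eq_add_of_lt hlt
        have : (x + z + 1) * q ^ 2 = x * q ^ 2 + (z + 1) * q ^ 2 := by ring
        have h5 : (z + 1) * 1 < (z + 1) * q ^ 2 := Nat.mul_lt_mul_of_pos_left hq2 (by omega)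
        omega
      have horb : a * q ^ (j + 2) % (q ^ m - 1) = y := by
        rw [pow_add, ← mul_assoc, Nat.mul_mod, hx, Nat.mul_mod_mod, hy, Nat.mul_add_mod_self_right,
          Nat.mod_eq_of_lt (by omega)]
      have := ih y hyx (j + 2) horb
      omega
  exact fun j => key _ j rfl

end Digits

/-! ### Signed counts of linear and cyclic words -/

section Counting

lemma sum_range_mul_eq {M : Type*} [AddCommMonoid M] (f : ℕ → M) (q n : ℕ) :
    ∑ a ∈ range (n * q), f a = ∑ a ∈ range n, ∑ d ∈ range q, f (q * a + d) := by
  induction n with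
  | zero => simp
  | succ n ih => rw [Nat.succ_mul, sum_range_add, ih, sum_range_succ, mul_comm n q]

lemma sum_range_pow_succ {M : Type*} [AddCommMonoid M] (f : ℕ → M) (q n : ℕ) :
    ∑ a ∈ range (q ^ (n + 1)), f a = ∑ a ∈ range (q ^ n), ∑ d ∈ range q, f (q * a + d) := by
  rw [pow_succ, sum_range_mul_eq]

/-- The sum of `x ^ d` over the digits `max(b, 1) ≤ d < q`. -/
def digitSum (q : ℕ) (x : ℤ) (b : ℕ) : ℤ :=
  ∑ d ∈ range q, if b ≤ d ∧ d ≠ 0 then x ^ d else 0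

open Classical in
/-- The sum of `x ^ a` over the linear words `a` with `n` digits. -/
noncomputable def linearSum (q b : ℕ) (x : ℤ) (n : ℕ) : ℤ :=
  ∑ a ∈ range (q ^ n), if IsLinearWord q b n a then x ^ a else 0

open Classical in
/-- The sum of `x ^ a` over the cyclic words `a` with `n` digits. -/
noncomputable def cyclicSum (q b : ℕ) (x : ℤ) (n : ℕ) : ℤ :=
  ∑ a ∈ range (q ^ n), if IsCyclicWord q b n a then x ^ a else 0

variable {q b : ℕ} {x : ℤ}

lemma linearSum_zero : linearSum q b x 0 = 1 := by
  simp [linearSum, IsLinearWord, windowsGE_of_lt_two]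

lemma linearSum_one : linearSum q b x 1 = digitSum q x 0 := by
  simp only [linearSum, IsLinearWord, windowsGE_of_lt_two, digitSum, pow_one, one_ne_zero,
    false_or, true_and, Nat.zero_le, Nat.one_lt_ofNat]
  refine sum_congr rfl fun d hd => ?_
  rw [Nat.mod_eq_of_lt (mem_range.mp hd)]

/-- Splitting off the last digit when it is required to vanish. -/
lemma sum_filter_mod_eq_zero (f : ℕ → ℤ) (P : ℕ → Prop) [DecidablePred P] (hq : 0 < q) (n : ℕ) :
    ∑ a ∈ range (q ^ (n + 1)), (if P a ∧ a % q = 0 then f a else 0) =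
      ∑ a ∈ range (q ^ n), if P (q * a) then f (q * a) else 0 := by
  rw [sum_range_pow_succ]
  refine sum_congr rfl fun a _ => ?_
  rw [sum_eq_single 0]
  · simp
  · intro d hd hd0
    rw [if_neg]
    rw [Nat.mul_add_mod, Nat.mod_eq_of_lt (mem_range.mp hd)]
    tauto
  · simp [hq.ne']

lemma linearSum_succ_succ (hb0 : 0 < b) (hb : b < q) (hx : x ^ q = x) (n : ℕ) :
    linearSum q b x (n + 2) =
      digitSum q x 0 * linearSum q b x (n + 1) + digitSum q x b * linearSum q b x n := by
  classical
  have hxa : ∀ a d, x ^ (q * a + d) = x ^ d * x ^ a := fun a d => by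
    rw [pow_add, pow_mul, hx, mul_comm]
  have h1 : ∑ a ∈ range (q ^ (n + 1)), (if WindowsGE q b (n + 1) a ∧ a % q = 0 then x ^ a else 0)
      = linearSum q b x n := by
    rw [sum_filter_mod_eq_zero _ _ (by omega), linearSum]
    refine sum_congr rfl fun a ha => ?_
    rw [windowsGE_succ_mul hb0 hb (mem_range.mp ha), pow_mul, hx]
  rw [← h1, linearSum, linearSum, sum_range_pow_succ, digitSum, digitSum, sum_mul_sum, sum_mul_sum,
    sum_comm, ← sum_add_distrib]
  refine sum_congr rfl fun d hd => ?_
  rw [← sum_add_distrib]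
  refine sum_congr rfl fun a _ => ?_
  rw [isLinearWord_succ_succ hb (mem_range.mp hd), hxa]
  have hexcl : IsLinearWord q b (n + 1) a → a % q ≠ 0 := fun h => by simpa using h.2
  by_cases hd0 : d = 0 <;> by_cases hbd : b ≤ d <;> by_cases hL : IsLinearWord q b (n + 1) a <;>
    by_cases hW : WindowsGE q b (n + 1) a <;> by_cases ha0 : a % q = 0 <;>
    simp_all

lemma cyclicSum_eq (hb0 : 0 < b) (hb : b < q) (hx : x ^ q = x) {n : ℕ} (hn : 0 < n) :
    cyclicSum q b x (n + 2) = linearSum q b x (n + 2) + digitSum q x b * linearSum q b x n := by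
  classical
  have hxn : ∀ k, x ^ q ^ k = x := fun k => by
    induction k with
    | zero => simp
    | succ k ih => rw [pow_succ, pow_mul, ih, hx]
  have hsplit : cyclicSum q b x (n + 2) = linearSum q b x (n + 2) +
      ∑ a ∈ range (q ^ (n + 2)), if (WindowsGE q b (n + 2) a ∧ b * q ^ (n + 1) ≤ a) ∧ a % q = 0
        then x ^ a else 0 := by
    rw [cyclicSum, linearSum, ← sum_add_distrib]
    refine sum_congr rfl fun a _ => ?_
    simp only [IsCyclicWord, IsLinearWord]
    by_cases hW : WindowsGE q b (n + 2) a <;> by_cases ha0 : a % q = 0 <;> simp [hW, ha0]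
  have hzero := sum_filter_mod_eq_zero (x ^ ·)
    (fun a => WindowsGE q b (n + 2) a ∧ b * q ^ (n + 1) ≤ a) (show 0 < q by omega) (n + 1)
  rw [hsplit, hzero, show range (q ^ (n + 1)) = range (q * q ^ n) by rw [pow_succ'],
    sum_range_mul_eq]
  congr 1
  rw [digitSum, linearSum, sum_mul_sum]
  refine sum_congr rfl fun h hh => ?_
  refine sum_congr rfl fun r hr => ?_
  rw [mem_range] at hh hr
  have hlt : q ^ n * h + r < q ^ (n + 1) := by
    rw [pow_succ]
    have : q ^ n * (h + 1) ≤ q ^ n * q := Nat.mul_le_mul_left _ hh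
    rw [mul_add, mul_one] at this
    omega
  rw [windowsGE_succ_mul hb0 hb hlt]
  have hle : b * q ^ (n + 1) ≤ q * (q ^ n * h + r) ↔ b ≤ h := by
    rw [show b * q ^ (n + 1) = q * (q ^ n * b) by ring, Nat.mul_le_mul_left_iff (by omega)]
    constructor
    · intro hle
      by_contra! hlt
      have : q ^ n * (h + 1) ≤ q ^ n * b := Nat.mul_le_mul_left _ hlt
      rw [mul_add, mul_one] at this
      omega
    · intro hle
      exact (Nat.mul_le_mul_left _ hle).trans (Nat.le_add_right _ _)
  have hx2 : x ^ (q * (q ^ n * h + r)) = x ^ h * x ^ r := by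
    rw [pow_mul, hx, pow_add, pow_mul, hxn]
  have hlin : 0 < h → (IsLinearWord q b (n + 1) (q ^ n * h + r) ↔ IsLinearWord q b n r) := by
    intro hh0
    obtain ⟨k, rfl⟩ : ∃ k, n = k + 1 := ⟨n - 1, by omega⟩
    have hmod : (q ^ (k + 1) * h + r) % q = r % q := by
      rw [show q ^ (k + 1) * h + r = q * (q ^ k * h) + r by ring, Nat.mul_add_mod]
    rw [IsLinearWord, IsLinearWord, mul_comm (q ^ (k + 1)), windowsGE_succ_top hb hh0 hh hr,
      mul_comm h, hmod]
    simp
  simp only [hle, hx2]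
  by_cases hbh : b ≤ h
  · have hh0 : h ≠ 0 := by omega
    simp [hbh, hh0, hlin (by omega)]
  · simp [hbh]

/-- The Lucas-type polynomial recursion in closed form. -/
lemma eq_sum_choose_of_recursion {R : Type*} [CommRing R] {A B : R} {L : ℕ → R}
    (h0 : L 0 = 1) (h1 : L 1 = A) (h2 : ∀ n, L (n + 2) = A * L (n + 1) + B * L n) (n : ℕ) :
    L n = ∑ t ∈ range (n + 1), (Nat.choose (n - t) t : R) * B ^ t * A ^ (n - 2 * t) := by
  induction n using Nat.twoStepInduction with
  | zero => simp [h0]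
  | one => simp [h1, sum_range_succ]
  | more n ih0 ih1 =>
    rw [h2, ih0, ih1, sum_range_succ' _ (n + 2), sum_range_succ' _ (n + 1), mul_add, mul_sum, mul_sum]
    have hlast : (Nat.choose (n + 2 - (n + 1 + 1)) (n + 1 + 1) : R) = 0 := by
      simp
    rw [sum_range_succ _ (n + 1), hlast]
    simp only [Nat.choose_zero_right, pow_zero, mul_zero, Nat.sub_zero, zero_mul, add_zero,
      Nat.cast_one, one_mul, mul_one]
    rw [add_right_comm, ← sum_add_distrib, ← pow_succ']
    congr 1
    refine sum_congr rfl fun t ht => ?_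
    rw [mem_range] at ht
    rw [show n + 2 - (t + 1) = (n - t) + 1 by omega, Nat.choose_succ_succ,
      show n + 1 - (t + 1) = n - t by omega, show n + 2 - 2 * (t + 1) = n - 2 * t by omega]
    by_cases hc : 2 * t + 1 ≤ n
    · rw [show n - 2 * t = (n + 1 - 2 * (t + 1)) + 1 by omega]
      push_cast
      ring
    · rw [Nat.choose_eq_zero_of_lt (show n - t < t + 1 by omega)]
      push_cast
      ring

/-- The closed form of a cyclic count in terms of the coefficients of the Lucas polynomials. -/
lemma sum_lucas {R : Type*} [CommRing R] {A B : R} {L : ℕ → R}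
    (h0 : L 0 = 1) (h1 : L 1 = A) (h2 : ∀ n, L (n + 2) = A * L (n + 1) + B * L n) (n : ℕ) :
    L (n + 2) + B * L n = ∑ t ∈ range ((n + 2) / 2 + 1),
      (((n + 2) * Nat.choose (n + 2 - t) t / (n + 2 - t) : ℕ) : R) *
        (B ^ t * A ^ (n + 2 - 2 * t)) := by
  have hcoef : ∀ t, t + 1 ≤ (n + 2) / 2 →
      (n + 2) * Nat.choose (n + 2 - (t + 1)) (t + 1) / (n + 2 - (t + 1)) =
        Nat.choose (n + 2 - (t + 1)) (t + 1) + Nat.choose (n - t) t := by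
    intro t ht
    apply Nat.div_eq_of_eq_mul_right (by omega)
    have h := Nat.add_one_mul_choose_eq (n - t) t
    rw [show n + 2 - (t + 1) = n - t + 1 by omega]
    have h' : n + 2 = (n - t + 1) + (t + 1) := by omega
    rw [h', add_mul, mul_add, h]
    ring
  have htrunc : ∀ k, ∑ t ∈ range (k + 1), (Nat.choose (k - t) t : R) * B ^ t * A ^ (k - 2 * t) =
      ∑ t ∈ range (k / 2 + 1), (Nat.choose (k - t) t : R) * B ^ t * A ^ (k - 2 * t) := by
    intro k
    symm
    apply sum_subset (range_subset_range.mpr (by omega))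
    intro t ht1 ht2
    rw [mem_range] at ht1 ht2
    rw [Nat.choose_eq_zero_of_lt (by omega)]
    simp
  rw [eq_sum_choose_of_recursion h0 h1 h2 n, eq_sum_choose_of_recursion h0 h1 h2 (n + 2), htrunc n,
    htrunc (n + 2), show (n + 2) / 2 = n / 2 + 1 by omega, sum_range_succ' _ (n / 2 + 1),
    sum_range_succ' _ (n / 2 + 1), mul_sum, add_right_comm, ← sum_add_distrib]
  congr 1
  · refine sum_congr rfl fun t ht => ?_
    rw [mem_range] at ht
    rw [hcoef t (by omega), show n + 2 - 2 * (t + 1) = n - 2 * t by omega]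
    push_cast
    ring
  · simp

lemma cyclicSum_eq_sum_lucas (hb0 : 0 < b) (hb : b < q) (hx : x ^ q = x) {n : ℕ} (hn : 0 < n) :
    cyclicSum q b x (n + 2) = ∑ t ∈ range ((n + 2) / 2 + 1),
      (((n + 2) * Nat.choose (n + 2 - t) t / (n + 2 - t) : ℕ) : ℤ) *
        (digitSum q x b ^ t * digitSum q x 0 ^ (n + 2 - 2 * t)) := by
  rw [cyclicSum_eq hb0 hb hx hn,
    sum_lucas linearSum_zero linearSum_one (linearSum_succ_succ hb0 hb hx)]

lemma digitSum_zero_eq : digitSum q x 0 = digitSum q x 1 := by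
  refine sum_congr rfl fun d _ => ?_
  simp [Nat.one_le_iff_ne_zero]

lemma digitSum_eq (hq : Odd q) (hb0 : 0 < b) (hb : b ≤ q) (hx : x ^ 2 = 1) :
    digitSum q x b = ((q - b + 1) / 2 : ℕ) + ((q - b) / 2 : ℕ) * x := by
  have hIco : digitSum q x b = ∑ d ∈ Ico b q, x ^ d := by
    rw [digitSum, ← sum_filter]
    refine sum_congr ?_ fun _ _ => rfl
    ext d
    simp only [mem_filter, mem_range, mem_Ico]
    omega
  rw [hIco]
  have key : ∀ s ≤ q, ∑ d ∈ Ico (q - s) q, x ^ d = ((s + 1) / 2 : ℕ) + (s / 2 : ℕ) * x := by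
    intro s
    induction s with
    | zero => simp
    | succ s ih =>
      intro hs
      rw [sum_eq_sum_Ico_succ_bot (by omega), show q - (s + 1) + 1 = q - s by omega,
        ih (by omega)]
      obtain ⟨r, hr⟩ := hq
      rcases Nat.even_or_odd' s with ⟨u, rfl | rfl⟩
      · rw [show q - (2 * u + 1) = 2 * (r - u) by omega, pow_mul, hx,
          show (2 * u + 1 + 1) / 2 = u + 1 by omega, show (2 * u + 1) / 2 = u by omega,
          show 2 * u / 2 = u by omega]
        push_cast
        ring
      · rw [show q - (2 * u + 1 + 1) = 2 * (r - u - 1) + 1 by omega, pow_succ, pow_mul, hx,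
          show (2 * u + 1 + 1 + 1) / 2 = u + 1 by omega, show (2 * u + 1 + 1) / 2 = u + 1 by omega,
          show (2 * u + 1) / 2 = u by omega]
        push_cast
        ring
  have h := key (q - b) (Nat.sub_le _ _)
  rwa [show q - (q - b) = b by omega] at h

open Classical in
lemma two_mul_card_odd_cyclicWord (m : ℕ) :
    2 * ((((range (q ^ m)).filter fun a => Odd a ∧ IsCyclicWord q b m a).card : ℕ) : ℤ) =
      cyclicSum q b 1 m - cyclicSum q b (-1) m := by
  rw [cyclicSum, cyclicSum, ← sum_sub_distrib, card_filter, Nat.cast_sum, mul_sum]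
  refine sum_congr rfl fun a _ => ?_
  rcases Nat.even_or_odd a with h | h
  · simp [h, h.neg_one_pow]
  · by_cases hc : IsCyclicWord q b m a <;> simp [h, h.neg_one_pow, hc]

end Counting

section BinomialParity

lemma sum_range_even_add_odd {M : Type*} [AddCommMonoid M] (f : ℕ → M) (K : ℕ) :
    ∑ r ∈ range (2 * K + 1), f r =
      ∑ i ∈ range (K + 1), f (2 * i) + ∑ i ∈ range K, f (2 * i + 1) := by
  induction K with
  | zero => simp
  | succ K ih =>
    rw [show 2 * (K + 1) + 1 = 2 * K + 1 + 1 + 1 by ring, sum_range_succ, sum_range_succ, ih,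
      sum_range_succ _ (K + 1), sum_range_succ _ K, sum_range_succ _ K,
      show 2 * (K + 1) = 2 * K + 1 + 1 by ring]
    abel

variable {R : Type*} [CommRing R] (o a : R) (K : ℕ)

lemma add_pow_even_odd_split :
    (a + o) ^ (2 * K) =
      ∑ i ∈ range (K + 1), (Nat.choose (2 * K) (2 * i) : R) * o ^ (2 * i) * a ^ (2 * K - 2 * i) +
      ∑ i ∈ range K, (Nat.choose (2 * K) (2 * i + 1) : R) * o ^ (2 * i + 1) *
        a ^ (2 * K - 2 * i - 1) := by
  rw [add_comm a, add_pow, sum_range_even_add_odd]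
  congr 1
  · exact sum_congr rfl fun i _ => by ring
  · exact sum_congr rfl fun i _ => by rw [Nat.sub_sub]; ring

lemma sub_pow_even_odd_split :
    (a - o) ^ (2 * K) =
      ∑ i ∈ range (K + 1), (Nat.choose (2 * K) (2 * i) : R) * o ^ (2 * i) * a ^ (2 * K - 2 * i) -
      ∑ i ∈ range K, (Nat.choose (2 * K) (2 * i + 1) : R) * o ^ (2 * i + 1) *
        a ^ (2 * K - 2 * i - 1) := by
  rw [sub_eq_add_neg, add_pow_even_odd_split, sub_eq_add_neg, ← sum_neg_distrib]
  congr 1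
  · exact sum_congr rfl fun i _ => by rw [(even_two_mul i).neg_pow]
  · exact sum_congr rfl fun i _ => by rw [(odd_two_mul_add_one i).neg_pow]; ring

lemma two_mul_sum_choose_mul_parity (f c o a K t : ℕ) :
    2 * ((∑ j ∈ range (t + 1), Nat.choose t j * f ^ j * c ^ (t - j) *
      (if j % 2 = 1 then
        ∑ i ∈ range (K + 1), Nat.choose (2 * K) (2 * i) * o ^ (2 * i) * a ^ (2 * K - 2 * i)
      else
        ∑ i ∈ range K, Nat.choose (2 * K) (2 * i + 1) * o ^ (2 * i + 1) *
          a ^ (2 * K - 2 * i - 1)) : ℕ) : ℤ) =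
      (c + f * 1) ^ t * (a + o * 1) ^ (2 * K) - (c + f * -1) ^ t * (a + o * -1) ^ (2 * K) := by
  rw [mul_neg_one, mul_neg_one, mul_one, mul_one, add_comm (c : ℤ) f, add_comm (c : ℤ) (-f),
    add_pow (f : ℤ), add_pow (-f : ℤ), sum_mul, sum_mul, ← sum_sub_distrib, Nat.cast_sum, mul_sum,
    ← sub_eq_add_neg, add_pow_even_odd_split, sub_pow_even_odd_split]
  refine sum_congr rfl fun j _ => ?_
  rcases Nat.even_or_odd j with h | h
  · rw [if_neg (by rw [Nat.even_iff] at h; omega), h.neg_pow]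
    push_cast
    ring
  · rw [if_pos (Nat.odd_iff.mp h), h.neg_pow]
    push_cast
    ring

end BinomialParity

theorem stmt_4 (q m b n δt'' δ k : ℕ)
    (hq : ∃ p e : ℕ, p.Prime ∧ Odd p ∧ 0 < e ∧ q = p ^ e)
    (hq3 : 3 ≤ q) (hm : 2 < m) (hme : Even m)
    (hb1 : 1 ≤ b) (hbq : b ≤ q - 1)
    (hn : 2 * n = q ^ m - 1)
    (hδt : δt'' = b * (q ^ m - 1) / (q ^ 2 - 1))
    (hδ : δ = (δt'' + 2) / 2)
    (hk : k = ∑ t ∈ Finset.range (m / 2 + 1),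
      m * Nat.choose (m - t) t / (m - t) *
        ∑ j ∈ Finset.range (t + 1),
          Nat.choose t j * ((q - b) / 2) ^ j * ((q - b + 1) / 2) ^ (t - j) *
            (if j % 2 = 1 then
              ∑ i ∈ Finset.range (m / 2 - t + 1),
                Nat.choose (m - 2 * t) (2 * i) * ((q - 1) / 2) ^ (2 * i) *
                  (q / 2) ^ (m - 2 * t - 2 * i)
            else
              ∑ i ∈ Finset.range (m / 2 - t),
                Nat.choose (m - 2 * t) (2 * i + 1) * ((q - 1) / 2) ^ (2 * i + 1) *
                  (q / 2) ^ (m - 2 * t - 2 * i - 1)))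
    (F E : Type*) [Field F] [Fintype F] [Field E] [Algebra F E]
    (hF : Fintype.card F = q)
    (γ : E) (hγ : IsPrimitiveRoot γ (2 * n)) :
    (∀ c ∈ negaBCH F n γ δ 0, c ≠ 0 → δ ≤ hWt c) ∧
    Module.finrank F (negaBCH F n γ δ 0) = k := by
  classical
  obtain ⟨p, e, -, hpodd, -, hqpe⟩ := hq
  have hqodd : Odd q := hqpe ▸ hpodd.pow
  have hqm4 : q ^ 4 ≤ q ^ m :=
    Nat.pow_le_pow_right (by omega) (by obtain ⟨r, rfl⟩ := hme; omega)
  have hq2 : 9 ≤ q ^ 2 := by nlinarith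
  have hqq : q ^ 4 = q ^ 2 * q ^ 2 := by ring
  have hN : 9 * 9 ≤ q ^ m := (Nat.mul_le_mul hq2 hq2).trans (hqq ▸ hqm4)
  have hdvd : q ^ 2 - 1 ∣ b * (q ^ m - 1) := by
    obtain ⟨r, rfl⟩ := even_iff_two_dvd.mp hme
    rw [pow_mul]
    exact (Nat.sub_one_dvd_pow_sub_one _ _).mul_left _
  have hDmul : δt'' * (q ^ 2 - 1) = b * (q ^ m - 1) := by rw [hδt, Nat.div_mul_cancel hdvd]
  have hD : δt'' * q ^ 2 = δt'' + b * (q ^ m - 1) := by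
    rw [← hDmul, Nat.mul_sub, mul_one]
    have := Nat.le_mul_of_pos_right δt'' (show 0 < q ^ 2 by omega)
    omega
  have hDlt : δt'' < q ^ m - 1 := by
    by_contra! h
    have h1 : (q ^ m - 1) * (q ^ 2 - 1) ≤ δt'' * (q ^ 2 - 1) := Nat.mul_le_mul_right _ h
    have h2 : b * (q ^ m - 1) < (q ^ 2 - 1) * (q ^ m - 1) := by
      apply Nat.mul_lt_mul_of_pos_right _ (by omega)
      have : q * 3 ≤ q ^ 2 := by nlinarith
      omega
    rw [hDmul, mul_comm] at h1
    omega
  have hDpos : 2 ≤ δt'' := by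
    by_contra! h
    have h1 : δt'' * (q ^ 2 - 1) ≤ 1 * (q ^ 2 - 1) := Nat.mul_le_mul_right _ (by omega)
    have h2 : 1 * (q ^ m - 1) ≤ b * (q ^ m - 1) := Nat.mul_le_mul_right _ hb1
    have h3 : q ^ 2 * 9 ≤ q ^ 2 * q ^ 2 := Nat.mul_le_mul_left _ hq2
    omega
  refine ⟨fun c hc hc0 => le_hWt_of_mem_negaBCH hγ hc hc0, ?_⟩
  have hmod : Fintype.card F ^ m ≡ 1 [MOD 2 * n] := by
    have h : q ^ m = 1 + 2 * n := by omega
    rw [hF, h]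
    simp [Nat.ModEq]
  rw [finrank_negaBCH_zero hγ (by omega) (by omega) hmod (hF ▸ hqodd) (by omega) (by omega) hδ, hF,
    hn]
  have hcyc : ((range (q ^ m - 1)).filter fun a =>
      Odd a ∧ ∀ j, δt'' ≤ a * q ^ j % (q ^ m - 1)).card =
      ((range (q ^ m)).filter fun a => Odd a ∧ IsCyclicWord q b m a).card := by
    congr 1
    ext a
    simp only [mem_filter, mem_range]
    constructor
    · rintro ⟨ha, hao, h⟩
      refine ⟨by omega, hao, ?_⟩
      rw [isCyclicWord_iff_forall_le (by omega) hb1 (by omega) ha]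
      exact (forall_le_orbit_iff (by omega) hb1 (by omega) hD hDlt).mp h
    · rintro ⟨ha, hao, h⟩
      have ha' : a < q ^ m - 1 := by
        have : Odd (q ^ m) := hqodd.pow
        rw [Nat.odd_iff] at this hao
        omega
      rw [isCyclicWord_iff_forall_le (by omega) hb1 (by omega) ha'] at h
      exact ⟨ha', hao, (forall_le_orbit_iff (by omega) hb1 (by omega) hD hDlt).mpr h⟩
  rw [hcyc, hk]
  obtain ⟨M, rfl⟩ : ∃ M, m = M + 2 := ⟨m - 2, by omega⟩
  apply Nat.cast_injective (R := ℤ)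
  apply mul_left_cancel₀ (two_ne_zero (α := ℤ))
  rw [two_mul_card_odd_cyclicWord, cyclicSum_eq_sum_lucas hb1 (by omega) (by simp) (by omega),
    cyclicSum_eq_sum_lucas hb1 (by omega) hqodd.neg_one_pow (by omega), ← sum_sub_distrib]
  rw [Nat.cast_sum, mul_sum]
  refine sum_congr rfl fun t ht => ?_
  rw [mem_range] at ht
  obtain ⟨K, hK⟩ : ∃ K, M + 2 - 2 * t = 2 * K := by
    obtain ⟨r, hr⟩ := hme
    exact ⟨r - t, by omega⟩
  rw [show (M + 2) / 2 - t = K by omega, hK, Nat.cast_mul, mul_left_comm (2 : ℤ),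
    two_mul_sum_choose_mul_parity, digitSum_zero_eq, digitSum_zero_eq,
    digitSum_eq hqodd hb1 (by omega) (by norm_num), digitSum_eq hqodd hb1 (by omega) (by norm_num),
    digitSum_eq hqodd one_pos (by omega) (by norm_num),
    digitSum_eq hqodd one_pos (by omega) (by norm_num), show q - 1 + 1 = q by omega]
  ring
end

section
/- Let q ≥ 3 be a power of an odd prime, let m ≥ 9 with m ≡ 0 (mod 3), and n = (q^m−1)/2. For 2 ≤ i ≤ 10, the i-th largest odd q-cyclotomic coset leader modulo 2n is δ_i′ = q^m − q^{m−1} − q^{2m/3 + ε} − q^{m/3 + ζ} − 1, where ε = −1 if i = 2, ε = 0 if 3 ≤ i ≤ 5, and ε = 1 if 6 ≤ i ≤ 10, and ζ = −1 if 2 ≤ i ≤ 3, ζ = i−4 if 4 ≤ i ≤ 5, and ζ = i−8 if 6 ≤ i ≤ 10. Moreover, for 4 ≤ i ≤ 10 the q-cyclotomic coset C_{δ_i′}^{2n} has exactly m elements. -/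
open Finset

/-- The cyclic rotation by `i` places of the `m`-digit base `q` expansion of `t`. -/
def rotate (q m i t : ℕ) : ℕ := t % q ^ i * q ^ (m - i) + t / q ^ i

theorem rotate_mul_add {q i H L : ℕ} (m : ℕ) (hL : L < q ^ i) :
    rotate q m i (H * q ^ i + L) = L * q ^ (m - i) + H := by
  have h0 : 0 < q ^ i := by omega
  unfold rotate
  rw [mul_comm H, Nat.mul_add_mod, Nat.mod_eq_of_lt hL, Nat.mul_add_div h0, Nat.div_eq_of_lt hL,
    add_zero]

theorem rotate_lt_pow {q m i t : ℕ} (hi : i ≤ m) (ht : t < q ^ m) : rotate q m i t < q ^ m := by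
  have hq : 0 < q ^ i := by
    rcases Nat.eq_zero_or_pos q with rfl | h
    · rcases Nat.eq_zero_or_pos i with rfl | h'
      · simp
      · rw [zero_pow (by omega)] at ht
        omega
    · positivity
  have e : q ^ m = q ^ i * q ^ (m - i) := by rw [← pow_add]; congr 1; omega
  have h1 : t % q ^ i + 1 ≤ q ^ i := Nat.mod_lt _ hq
  have h2 : t / q ^ i < q ^ (m - i) := by
    rw [Nat.div_lt_iff_lt_mul hq, mul_comm, ← e]; exact ht
  have h3 := Nat.mul_le_mul_right (q ^ (m - i)) h1
  unfold rotate
  rw [e]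
  linarith

theorem rotate_modEq {q m i : ℕ} (hi : i ≤ m) (hq : 0 < q) (t : ℕ) :
    rotate q m i t ≡ t * q ^ (m - i) [MOD (q ^ m - 1)] := by
  have h1 : q ^ m ≡ 1 [MOD (q ^ m - 1)] :=
    ((Nat.modEq_iff_dvd' (Nat.one_le_pow _ _ hq)).2 dvd_rfl).symm
  have e : t * q ^ (m - i) = t % q ^ i * q ^ (m - i) + t / q ^ i * q ^ m := by
    have : q ^ m = q ^ i * q ^ (m - i) := by rw [← pow_add]; congr 1; omega
    rw [this]
    nth_rewrite 1 [← Nat.mod_add_div t (q ^ i)]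
    ring
  rw [e]
  unfold rotate
  have := (h1.mul_left (t / q ^ i)).add_left (t % q ^ i * q ^ (m - i))
  simpa using this.symm

theorem pow_coprime_pow_sub_one {q m : ℕ} (hq : 0 < q) (hm : 0 < m) (j : ℕ) :
    Nat.Coprime (q ^ j) (q ^ m - 1) := by
  apply Nat.Coprime.pow_left
  have h1 : 1 ≤ q ^ m := Nat.one_le_pow _ _ hq
  have h2 : Nat.Coprime (q ^ m) (q ^ m - 1) := by
    have : Nat.Coprime (q ^ m - 1 + 1) (q ^ m - 1) := by simp
    rwa [Nat.sub_add_cancel h1] at this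
  exact h2.coprime_dvd_left (dvd_pow_self q (by omega))

theorem rotate_pos_lt {q m i t : ℕ} (hq : 0 < q) (hm : 0 < m) (hi : i ≤ m) (ht0 : 0 < t)
    (ht : t < q ^ m - 1) : 0 < rotate q m i t ∧ rotate q m i t < q ^ m - 1 := by
  have hlt := rotate_lt_pow hi (show t < q ^ m by omega)
  have hmod := rotate_modEq hi hq t
  have hnd : ¬ (q ^ m - 1) ∣ rotate q m i t := by
    intro hd
    have h1 := (hmod.dvd_iff dvd_rfl).1 hd
    have h2 := (pow_coprime_pow_sub_one hq hm (m - i)).symm.dvd_of_dvd_mul_right h1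
    have := Nat.le_of_dvd ht0 h2
    omega
  constructor
  · rcases Nat.eq_zero_or_pos (rotate q m i t) with h | h
    · rw [h] at hnd; simp at hnd
    · exact h
  · rcases Nat.lt_or_ge (rotate q m i t) (q ^ m - 1) with h | h
    · exact h
    · have : rotate q m i t = q ^ m - 1 := by omega
      rw [this] at hnd; simp at hnd

theorem complement_mul_pow_mod {q m i t : ℕ} (hq : 0 < q) (hm : 0 < m) (hi : i ≤ m) (ht0 : 0 < t)
    (ht : t < q ^ m - 1) :
    (q ^ m - 1 - t) * q ^ (m - i) % (q ^ m - 1) = q ^ m - 1 - rotate q m i t := by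
  obtain ⟨h0, h1⟩ := rotate_pos_lt hq hm hi ht0 ht
  have hmod := rotate_modEq hi hq t
  set N := q ^ m - 1
  set u := rotate q m i t
  have h2 : (N - t) * q ^ (m - i) + t * q ^ (m - i) ≡ (N - u) + t * q ^ (m - i) [MOD N] := by
    have e1 : (N - t) * q ^ (m - i) + t * q ^ (m - i) = N * q ^ (m - i) := by
      rw [← add_mul]; congr 1; omega
    have e2 : (N - u) + u = N := by omega
    calc _ = N * q ^ (m - i) := e1
      _ ≡ N [MOD N] := by simp [Nat.ModEq]
      _ = (N - u) + u := e2.symm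
      _ ≡ _ [MOD N] := hmod.add_left _
  have h3 := Nat.ModEq.add_right_cancel' _ h2
  rw [Nat.ModEq, Nat.mod_eq_of_lt (show N - u < N by omega)] at h3
  exact h3

theorem pow_mod_exponent_modEq {q m : ℕ} (hq : 0 < q) (j : ℕ) :
    q ^ j ≡ q ^ (j % m) [MOD (q ^ m - 1)] := by
  have h1 : q ^ m ≡ 1 [MOD (q ^ m - 1)] :=
    ((Nat.modEq_iff_dvd' (Nat.one_le_pow _ _ hq)).2 dvd_rfl).symm
  have := ((h1.pow (j / m)).mul_left (q ^ (j % m)))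
  rw [← pow_mul, ← pow_add, Nat.mod_add_div, one_pow, mul_one] at this
  exact this

theorem complement_leader_iff {q m t : ℕ} (hq : 0 < q) (hm : 0 < m) (ht0 : 0 < t)
    (ht : t < q ^ m - 1) :
    (∀ j, q ^ m - 1 - t ≤ (q ^ m - 1 - t) * q ^ j % (q ^ m - 1)) ↔
      ∀ i, 0 < i → i < m → rotate q m i t ≤ t := by
  constructor
  · intro h i _ h1
    have := h (m - i)
    rw [complement_mul_pow_mod hq hm h1.le ht0 ht] at this
    have := rotate_pos_lt hq hm h1.le ht0 ht
    omega
  · intro h j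
    have e : (q ^ m - 1 - t) * q ^ j % (q ^ m - 1) =
        (q ^ m - 1 - t) * q ^ (j % m) % (q ^ m - 1) :=
      (pow_mod_exponent_modEq hq j).mul_left _
    rw [e]
    have hj := Nat.mod_lt j hm
    rcases Nat.eq_zero_or_pos (j % m) with h0 | h0
    · rw [h0, pow_zero, mul_one, Nat.mod_eq_of_lt (by omega)]
    · have e2 : j % m = m - (m - j % m) := by omega
      rw [e2, complement_mul_pow_mod hq hm (by omega) ht0 ht]
      have := h (m - j % m) (by omega) (by omega)
      omega

theorem ncard_qCoset_complement {q m t : ℕ} (hq : 0 < q) (hm : 0 < m) (ht0 : 0 < t)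
    (ht : t < q ^ m - 1) (h : ∀ i, 0 < i → i < m → rotate q m i t < t) :
    (qCoset q (q ^ m - 1) (q ^ m - 1 - t)).ncard = m := by
  have key : ∀ x y : ℕ, x < y → y < m →
      ¬ ((q ^ m - 1 - t) * q ^ x ≡ (q ^ m - 1 - t) * q ^ y [MOD (q ^ m - 1)]) := by
    intro x y hxy hy hmod
    have e : (q ^ m - 1 - t) * q ^ y = (q ^ m - 1 - t) * q ^ (y - x) * q ^ x := by
      rw [mul_assoc, ← pow_add]; congr 2; omega
    rw [e] at hmod
    have h1 := Nat.ModEq.cancel_right_of_coprime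
      (pow_coprime_pow_sub_one hq hm x).symm hmod
    have e2 : y - x = m - (m - (y - x)) := by omega
    rw [Nat.ModEq, Nat.mod_eq_of_lt (by omega), e2,
      complement_mul_pow_mod hq hm (by omega) ht0 ht] at h1
    have h2 := h (m - (y - x)) (by omega) (by omega)
    omega
  have himg : qCoset q (q ^ m - 1) (q ^ m - 1 - t) =
      (fun j : ℕ => (((q ^ m - 1 - t) * q ^ j : ℕ) : ZMod (q ^ m - 1))) ''
        (Finset.range m : Set ℕ) := by
    ext x
    simp only [qCoset, Set.mem_range, Set.mem_image, Finset.coe_range, Set.mem_Iio]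
    constructor
    · rintro ⟨j, rfl⟩
      refine ⟨j % m, Nat.mod_lt j hm, ?_⟩
      have := (ZMod.natCast_eq_natCast_iff _ _ _).2
        ((pow_mod_exponent_modEq (m := m) hq j).mul_left (q ^ m - 1 - t))
      rw [← this]
      push_cast
      rfl
    · rintro ⟨j, _, rfl⟩
      exact ⟨j, by push_cast; rfl⟩
  rw [himg, Set.InjOn.ncard_image, Set.ncard_coe_finset, Finset.card_range]
  intro x hx y hy hxy
  simp only [Finset.coe_range, Set.mem_Iio] at hx hy
  have hmod := (ZMod.natCast_eq_natCast_iff _ _ _).1 hxy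
  rcases Nat.lt_trichotomy x y with h1 | h1 | h1
  · exact absurd hmod (key x y h1 hy)
  · exact h1
  · exact absurd hmod.symm (key y x h1 hx)

theorem three_mul_pow_le_pow {q x y : ℕ} (hq : 3 ≤ q) (h : x < y) : 3 * q ^ x ≤ q ^ y :=
  calc 3 * q ^ x ≤ q * q ^ x := Nat.mul_le_mul_right _ hq
    _ = q ^ (x + 1) := by ring
    _ ≤ q ^ y := Nat.pow_le_pow_right (by omega) h

theorem pow_add_pow_lt {q a b a' b' : ℕ} (hq : 3 ≤ q) (hb : b < a)
    (h : a < a' ∨ a = a' ∧ b < b') : q ^ a + q ^ b < q ^ a' + q ^ b' := by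
  have h0 : ∀ x, 0 < q ^ x := fun x => by positivity
  rcases h with h | ⟨rfl, h⟩
  · have := three_mul_pow_le_pow hq h
    have := three_mul_pow_le_pow hq hb
    have := h0 a
    omega
  · have := three_mul_pow_le_pow hq h
    have := h0 b
    omega

theorem exponent_le_of_pow_add_pow_le {q x y a b R : ℕ} (hq : 3 ≤ q)
    (h : q ^ x + q ^ y ≤ q ^ a + R) (hRa : R < q ^ a) (hRb : R < q ^ (b + 1)) :
    x ≤ a ∧ (x = a → y ≤ b) := by
  refine ⟨?_, ?_⟩
  · by_contra! hlt
    have := three_mul_pow_le_pow hq hlt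
    omega
  · rintro rfl
    by_contra! hlt
    have : q ^ (b + 1) ≤ q ^ y := Nat.pow_le_pow_right (by omega) hlt
    omega

theorem exists_leading_one_of_rotate_le {q m t H L w : ℕ} (hq : 3 ≤ q) (hw : w ≤ m)
    (hmax : ∀ i, 0 < i → i < m → rotate q m i t ≤ t) (ht : t < 2 * q ^ (m - 1))
    (hL0 : 0 < L) (hL : L < q ^ w) (e : t = H * q ^ w + L) :
    ∃ x L', x < w ∧ L = q ^ x + L' ∧ L' < q ^ x ∧
      q ^ (m - 1) + L' * q ^ (m - 1 - x) + H * q ^ (w - 1 - x) ≤ t := by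
  have hx1 : q ^ Nat.log q L ≤ L := Nat.pow_log_le_self q (by omega)
  have hx2 : L < q ^ (Nat.log q L + 1) := Nat.lt_pow_succ_log_self (by omega) L
  have hxw : Nat.log q L < w := by
    by_contra! hlt
    have : q ^ w ≤ q ^ Nat.log q L := Nat.pow_le_pow_right (by omega) hlt
    omega
  generalize Nat.log q L = x at hx1 hx2 hxw
  have hrot : L * q ^ (m - 1 - x) + H * q ^ (w - 1 - x) ≤ t := by
    have e1 : t = H * q ^ (w - 1 - x) * q ^ (x + 1) + L := by
      rw [e, mul_assoc, ← pow_add]; congr 3; omega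
    rcases Nat.lt_or_ge (x + 1) m with h | h
    · have h1 := hmax (x + 1) (by omega) h
      have h2 := rotate_mul_add (H := H * q ^ (w - 1 - x)) m hx2
      rw [← e1] at h2
      rw [h2] at h1
      have e2 : m - (x + 1) = m - 1 - x := by omega
      rwa [e2] at h1
    · have hw' : w = x + 1 := by omega
      have hm' : m = x + 1 := by omega
      subst hw' hm'
      have : 0 < q ^ (x + 1) := by positivity
      simp only [Nat.add_sub_cancel, Nat.sub_self, pow_zero, mul_one]
      rw [e]
      nlinarith
  have em : q ^ (m - 1) = q ^ x * q ^ (m - 1 - x) := by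
    rw [← pow_add]; congr 1; omega
  have hp : 0 < q ^ (m - 1 - x) := by positivity
  have hL2 : L < 2 * q ^ x := by
    by_contra! hge
    have := Nat.mul_le_mul_right (q ^ (m - 1 - x)) hge
    rw [em] at ht
    have := Nat.zero_le (H * q ^ (w - 1 - x))
    linarith
  refine ⟨x, L - q ^ x, hxw, by omega, by omega, ?_⟩
  obtain ⟨L', rfl⟩ := Nat.exists_eq_add_of_le hx1
  rw [Nat.add_sub_cancel_left, em]
  linarith

theorem odd_of_rotate_le_cases {q k t : ℕ} (hq : 3 ≤ q) (hqo : Odd q) (hk : 3 ≤ k) (hto : Odd t)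
    (hmax : ∀ i, 0 < i → i < 3 * k → rotate q (3 * k) i t ≤ t)
    (ht : t ≤ q ^ (3 * k - 1) + q ^ (2 * k + 1) + q ^ (k + 2)) :
    t = q ^ (3 * k - 1) ∨ ∃ a b, t = q ^ (3 * k - 1) + q ^ a + q ^ b ∧
      (a = 2 * k - 1 ∧ b = k - 1 ∨ a = 2 * k ∧ k - 1 ≤ b ∧ b ≤ k + 1 ∨
        a = 2 * k + 1 ∧ k - 2 ≤ b ∧ b ≤ k + 2) := by
  have h0 : ∀ x, 0 < q ^ x := fun x => by positivity
  have ho : ∀ x, q ^ x % 2 = 1 := fun x => Nat.odd_iff.1 hqo.pow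
  have hto' := Nat.odd_iff.1 hto
  have hlt : t < 2 * q ^ (3 * k - 1) := by
    have := three_mul_pow_le_pow (x := 2 * k + 1) (y := 3 * k - 1) hq (by omega)
    have := three_mul_pow_le_pow (x := k + 2) (y := 2 * k + 1) hq (by omega)
    have := h0 (k + 2)
    omega
  obtain ⟨x, r, hx, et, hr, hm1⟩ := exists_leading_one_of_rotate_le (H := 0) (L := t) (w := 3 * k)
    hq le_rfl hmax hlt (by omega)
    (by have := three_mul_pow_le_pow (x := 3 * k - 1) (y := 3 * k) hq (by omega); omega) (by simp)
  have hx' : x = 3 * k - 1 := by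
    by_contra hne
    have := three_mul_pow_le_pow (x := x) (y := 3 * k - 1) hq (by omega)
    omega
  subst hx'
  clear hm1 hx
  rcases Nat.eq_zero_or_pos r with hr0 | hr0
  · left; omega
  right
  obtain ⟨a, r', ha, er, hr', ha1⟩ := exists_leading_one_of_rotate_le (H := 1) (L := r)
    (w := 3 * k - 1) hq (by omega) hmax hlt hr0 hr (by omega)
  have := ho (3 * k - 1)
  have := ho a
  obtain ⟨b, r2, hb, er', hr2, hb1⟩ := exists_leading_one_of_rotate_le
    (H := q ^ (3 * k - 1 - a) + 1) (L := r')
    (w := a) hq (by omega) hmax hlt (by omega) hr'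
    (by rw [add_mul, ← pow_add, show 3 * k - 1 - a + a = 3 * k - 1 by omega]; omega)
  have := ho b
  have h3 : ∀ x, 3 * q ^ x ≤ q ^ (x + 1) := fun x => three_mul_pow_le_pow hq (Nat.lt_succ_self x)
  have hr'b : r' < q ^ (b + 1) := by have := h3 b; omega
  have A : b + (3 * k - 1 - a) ≤ a ∧ (b + (3 * k - 1 - a) = a → 3 * k - 1 - 1 - a ≤ b) := by
    refine exponent_le_of_pow_add_pow_le hq (R := r') ?_ hr' hr'b
    rw [er', add_mul, ← pow_add] at ha1
    have := Nat.zero_le (r2 * q ^ (3 * k - 1 - a))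
    omega
  have B : 3 * k - 1 - a + (a - 1 - b) ≤ a ∧ (3 * k - 1 - a + (a - 1 - b) = a → a - 1 - b ≤ b) := by
    refine exponent_le_of_pow_add_pow_le hq (R := r') ?_ hr' hr'b
    rw [add_mul, ← pow_add] at hb1
    have := Nat.zero_le (r2 * q ^ (3 * k - 1 - b))
    omega
  have C : a ≤ 2 * k + 1 := by
    by_contra! hlt
    have := three_mul_pow_le_pow hq hlt
    have := three_mul_pow_le_pow (x := k + 2) (y := 2 * k + 1) hq (by omega)
    have := h0 (2 * k + 1)
    omega
  have D : a = 2 * k + 1 → b ≤ k + 2 ∧ (b = k + 2 → r2 = 0) := by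
    rintro rfl
    refine ⟨?_, ?_⟩
    · by_contra! hlt
      have := three_mul_pow_le_pow hq hlt
      have := h0 (k + 2)
      omega
    · rintro rfl
      omega
  rcases Nat.eq_zero_or_pos r2 with hr20 | hr20
  · exact ⟨a, b, by omega, by omega⟩
  exfalso
  have et2 : t = (q ^ (3 * k - 1 - b) + q ^ (a - b) + 1) * q ^ b + r2 := by
    rw [add_mul, add_mul, ← pow_add, ← pow_add, show 3 * k - 1 - b + b = 3 * k - 1 by omega,
      show a - b + b = a by omega]
    omega
  obtain ⟨c, r3, hc, er2, hr3, hc1⟩ := exists_leading_one_of_rotate_le hq (by omega) hmax hlt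
    hr20 hr2 et2
  have := ho c
  have et3 : t = (q ^ (3 * k - 1 - c) + q ^ (a - c) + q ^ (b - c) + 1) * q ^ c + r3 := by
    rw [add_mul, add_mul, add_mul, ← pow_add, ← pow_add, ← pow_add,
      show 3 * k - 1 - c + c = 3 * k - 1 by omega, show a - c + c = a by omega,
      show b - c + c = b by omega]
    omega
  obtain ⟨d, r4, hd, er3, hr4, hd1⟩ := exists_leading_one_of_rotate_le hq (by omega) hmax hlt
    (by omega) hr3 et3
  have E : c + (3 * k - 1 - b) ≤ a ∧ (c + (3 * k - 1 - b) = a → d + (3 * k - 1 - b) ≤ b) := by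
    refine exponent_le_of_pow_add_pow_le hq (R := r') ?_ hr' hr'b
    rw [er2, er3, add_mul, add_mul, ← pow_add, ← pow_add] at hb1
    omega
  have F : d + (3 * k - 1 - c) ≤ a ∧
      (d + (3 * k - 1 - c) = a → 3 * k - 1 - b + (b - 1 - c) ≤ b) := by
    refine exponent_le_of_pow_add_pow_le hq (R := r') ?_ hr' hr'b
    rw [er3, add_mul, add_mul, add_mul, ← pow_add, ← pow_add, ← pow_add] at hc1
    omega
  have G : 3 * k - 1 - c + (c - 1 - d) ≤ a ∧
      (3 * k - 1 - c + (c - 1 - d) = a → a - c + (c - 1 - d) ≤ b) := by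
    refine exponent_le_of_pow_add_pow_le hq (R := r') ?_ hr' hr'b
    rw [add_mul, add_mul, add_mul, ← pow_add, ← pow_add, ← pow_add] at hd1
    omega
  omega

theorem rotate_one_digit_le {q m i : ℕ} (hq : 0 < q) (hi : i < m) :
    rotate q m i (q ^ (m - 1)) ≤ q ^ (m - 1) := by
  have e : q ^ (m - 1) = q ^ (m - 1 - i) * q ^ i + 0 := by
    rw [← pow_add, add_zero]; congr 1; omega
  have h := rotate_mul_add (q := q) (i := i) (H := q ^ (m - 1 - i)) (L := 0) m (by positivity)
  rw [← e] at h
  rw [h, zero_mul, zero_add]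
  exact Nat.pow_le_pow_right hq (by omega)

theorem rotate_three_digits_low {q m a b : ℕ} (hq : 3 ≤ q) (ha : a < m - 1) (hb : b < a) :
    rotate q m (b + 1) (q ^ (m - 1) + q ^ a + q ^ b) =
      q ^ (m - 1) + q ^ (m - 2 - b) + q ^ (a - 1 - b) := by
  have e : q ^ (m - 1) + q ^ a + q ^ b =
      (q ^ (m - 2 - b) + q ^ (a - 1 - b)) * q ^ (b + 1) + q ^ b := by
    rw [add_mul, ← pow_add, ← pow_add]; congr 3 <;> omega
  rw [e, rotate_mul_add m (Nat.pow_lt_pow_right (by omega) (by omega)), ← pow_add,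
    show b + (m - (b + 1)) = m - 1 by omega, add_assoc]

theorem rotate_three_digits_high {q m a b : ℕ} (hq : 3 ≤ q) (ha : a < m - 1) (hb : b < a) :
    rotate q m (a + 1) (q ^ (m - 1) + q ^ a + q ^ b) =
      q ^ (m - 1) + q ^ (b + (m - 1 - a)) + q ^ (m - 2 - a) := by
  have h0 : 0 < q ^ a := by positivity
  have e : q ^ (m - 1) + q ^ a + q ^ b = q ^ (m - 2 - a) * q ^ (a + 1) + (q ^ a + q ^ b) := by
    rw [← pow_add, add_assoc]; congr 2; omega
  have hL : q ^ a + q ^ b < q ^ (a + 1) := by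
    have := three_mul_pow_le_pow hq (Nat.lt_succ_self a)
    have := three_mul_pow_le_pow hq hb
    simp only [Nat.succ_eq_add_one] at *
    omega
  rw [e, rotate_mul_add m hL, add_mul, ← pow_add, ← pow_add,
    show a + (m - (a + 1)) = m - 1 by omega, show m - (a + 1) = m - 1 - a by omega]

theorem rotate_three_digits_lt {q m i a b : ℕ} (hq : 3 ≤ q) (ha : a < m - 1) (hb : b < a)
    (hi0 : 0 < i) (hi : i < m) (hia : i ≠ a + 1) (hib : i ≠ b + 1) :
    rotate q m i (q ^ (m - 1) + q ^ a + q ^ b) < q ^ (m - 1) + q ^ a + q ^ b := by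
  have h0 : ∀ x, 0 < q ^ x := fun x => by positivity
  have hle : ∀ x, x ≤ m - 2 → 3 * q ^ x ≤ q ^ (m - 1) := fun x hx =>
    three_mul_pow_le_pow hq (by omega)
  rcases Nat.lt_or_ge b i with h1 | h1
  · rcases Nat.lt_or_ge a i with h2 | h2
    · have e : q ^ (m - 1) + q ^ a + q ^ b = q ^ (m - 1 - i) * q ^ i + (q ^ a + q ^ b) := by
        rw [← pow_add, add_assoc]; congr 2; omega
      have hL : q ^ a + q ^ b < q ^ i := by
        have := three_mul_pow_le_pow hq h2
        have := three_mul_pow_le_pow hq hb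
        have := h0 a
        omega
      have hrot := rotate_mul_add (H := q ^ (m - 1 - i)) m hL
      rw [← e, add_mul, ← pow_add, ← pow_add] at hrot
      rw [hrot]
      have := hle (a + (m - i)) (by omega)
      have := hle (b + (m - i)) (by omega)
      have := hle (m - 1 - i) (by omega)
      have := h0 a
      omega
    · have e : q ^ (m - 1) + q ^ a + q ^ b =
          (q ^ (m - 1 - i) + q ^ (a - i)) * q ^ i + q ^ b := by
        rw [add_mul, ← pow_add, ← pow_add]; congr 3 <;> omega
      have hrot := rotate_mul_add (H := q ^ (m - 1 - i) + q ^ (a - i)) m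
        (Nat.pow_lt_pow_right (show 1 < q by omega) h1)
      rw [← e, ← pow_add] at hrot
      rw [hrot]
      have := hle (b + (m - i)) (by omega)
      have := hle (m - 1 - i) (by omega)
      have := hle (a - i) (by omega)
      have := h0 a
      omega
  · have e : q ^ (m - 1) + q ^ a + q ^ b =
        (q ^ (m - 1 - i) + q ^ (a - i) + q ^ (b - i)) * q ^ i + 0 := by
      rw [add_mul, add_mul, ← pow_add, ← pow_add, ← pow_add, add_zero]; congr 3 <;> omega
    have hrot := rotate_mul_add (H := q ^ (m - 1 - i) + q ^ (a - i) + q ^ (b - i)) m (h0 i)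
    rw [← e, zero_mul, zero_add] at hrot
    rw [hrot]
    have := three_mul_pow_le_pow (x := m - 1 - i) (y := m - 1) hq (by omega)
    have := three_mul_pow_le_pow (x := a - i) (y := a) hq (by omega)
    have := three_mul_pow_le_pow (x := b - i) (y := b) hq (by omega)
    have := h0 a
    omega

theorem rotate_three_digits_lt_self {q m i a b : ℕ} (hq : 3 ≤ q) (ha : a < m - 1) (hb : b < a)
    (hlow : m - 2 - b < a)
    (hhigh : b + (m - 1 - a) < a ∨ b + (m - 1 - a) = a ∧ m - 2 - a < b)
    (hi0 : 0 < i) (hi : i < m) :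
    rotate q m i (q ^ (m - 1) + q ^ a + q ^ b) < q ^ (m - 1) + q ^ a + q ^ b := by
  rcases eq_or_ne i (a + 1) with rfl | hia
  · rw [rotate_three_digits_high hq ha hb, add_assoc, add_assoc]
    exact Nat.add_lt_add_left (pow_add_pow_lt hq (by omega) hhigh) _
  rcases eq_or_ne i (b + 1) with rfl | hib
  · rw [rotate_three_digits_low hq ha hb, add_assoc, add_assoc]
    exact Nat.add_lt_add_left (pow_add_pow_lt hq (by omega) (Or.inl hlow)) _
  exact rotate_three_digits_lt hq ha hb hi0 hi hia hib

/-- The exponent of the middle nonzero digit of the complement of the `l`-th largest odd leader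
modulo `q ^ (3 * k) - 1`. -/
def middleExponent (k l : ℕ) : ℕ :=
  if l = 2 then 2 * k - 1 else if l ≤ 5 then 2 * k else 2 * k + 1

/-- The exponent of the last nonzero digit of the complement of the `l`-th largest odd leader
modulo `q ^ (3 * k) - 1`. -/
def lastExponent (k l : ℕ) : ℕ :=
  if l ≤ 3 then k - 1 else if l ≤ 5 then k + l - 4 else k + l - 8

/-- The complement of the `l`-th largest odd leader modulo `q ^ (3 * k) - 1`. -/
def complementLeader (q k l : ℕ) : ℕ :=
  if l = 1 then q ^ (3 * k - 1)
  else q ^ (3 * k - 1) + q ^ middleExponent k l + q ^ lastExponent k l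

theorem lastExponent_lt_middleExponent {k l : ℕ} (hk : 3 ≤ k) (hl : l ≤ 10) :
    lastExponent k l < middleExponent k l := by
  unfold middleExponent lastExponent
  split_ifs <;> omega

theorem middleExponent_lt {k : ℕ} (hk : 3 ≤ k) (l : ℕ) : middleExponent k l < 3 * k - 1 := by
  unfold middleExponent
  split_ifs <;> omega

theorem complementLeader_lt {q k l l' : ℕ} (hq : 3 ≤ q) (hk : 3 ≤ k) (hl : 1 ≤ l) (hll' : l < l')
    (hl' : l' ≤ 10) : complementLeader q k l < complementLeader q k l' := by
  unfold complementLeader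
  rw [if_neg (by omega : l' ≠ 1)]
  split_ifs with h
  · have h0 : ∀ x, 0 < q ^ x := fun x => by positivity
    have := h0 (middleExponent k l')
    omega
  · rw [add_assoc, add_assoc]
    refine Nat.add_lt_add_left (pow_add_pow_lt hq
      (lastExponent_lt_middleExponent hk (by omega)) ?_) _
    unfold middleExponent lastExponent
    split_ifs <;> omega

theorem complementLeader_le_iff {q k l l' : ℕ} (hq : 3 ≤ q) (hk : 3 ≤ k) (hl : 1 ≤ l)
    (hl10 : l ≤ 10) (hl'1 : 1 ≤ l') (hl' : l' ≤ 10) :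
    complementLeader q k l ≤ complementLeader q k l' ↔ l ≤ l' := by
  constructor
  · intro h
    by_contra! hlt
    have := complementLeader_lt hq hk hl'1 hlt hl10
    omega
  · intro h
    rcases Nat.lt_or_eq_of_le h with h | rfl
    · exact (complementLeader_lt hq hk hl h hl').le
    · exact le_rfl

theorem rotate_complementLeader_lt {q k l i : ℕ} (hq : 3 ≤ q) (hk : 3 ≤ k) (hl : 3 ≤ l)
    (hl10 : l ≤ 10) (hi0 : 0 < i) (hi : i < 3 * k) :
    rotate q (3 * k) i (complementLeader q k l) < complementLeader q k l := by
  unfold complementLeader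
  rw [if_neg (by omega)]
  refine rotate_three_digits_lt_self hq (middleExponent_lt hk l)
    (lastExponent_lt_middleExponent hk hl10) ?_ ?_ hi0 hi <;>
  · unfold middleExponent lastExponent
    split_ifs <;> omega

theorem rotate_complementLeader_le {q k l i : ℕ} (hq : 3 ≤ q) (hk : 3 ≤ k) (hl : 1 ≤ l)
    (hl10 : l ≤ 10) (hi0 : 0 < i) (hi : i < 3 * k) :
    rotate q (3 * k) i (complementLeader q k l) ≤ complementLeader q k l := by
  rcases Nat.lt_or_ge l 3 with h | h
  · obtain rfl | rfl : l = 1 ∨ l = 2 := by omega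
    · exact rotate_one_digit_le (by omega) hi
    · simp only [complementLeader, middleExponent, lastExponent]
      norm_num
      have ha : 2 * k - 1 < 3 * k - 1 := by omega
      have hb : k - 1 < 2 * k - 1 := by omega
      rcases eq_or_ne i (2 * k - 1 + 1) with rfl | hia
      · rw [rotate_three_digits_high hq ha hb]
        rw [show k - 1 + (3 * k - 1 - (2 * k - 1)) = 2 * k - 1 by omega,
          show 3 * k - 2 - (2 * k - 1) = k - 1 by omega]
      rcases eq_or_ne i (k - 1 + 1) with rfl | hib
      · rw [rotate_three_digits_low hq ha hb]
        rw [show 3 * k - 2 - (k - 1) = 2 * k - 1 by omega,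
          show 2 * k - 1 - 1 - (k - 1) = k - 1 by omega]
      exact (rotate_three_digits_lt hq ha hb hi0 hi hia hib).le
  · exact (rotate_complementLeader_lt hq hk h hl10 hi0 hi).le

theorem odd_complementLeader {q : ℕ} (hq : Odd q) (k l : ℕ) : Odd (complementLeader q k l) := by
  have ho : ∀ x, q ^ x % 2 = 1 := fun x => Nat.odd_iff.1 hq.pow
  unfold complementLeader
  have := ho (3 * k - 1)
  have := ho (middleExponent k l)
  have := ho (lastExponent k l)
  rw [Nat.odd_iff]
  split_ifs <;> omega

theorem complementLeader_lt_pow {q k l : ℕ} (hq : 3 ≤ q) (hk : 3 ≤ k) (hl10 : l ≤ 10) :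
    complementLeader q k l < q ^ (3 * k) - 1 := by
  have h0 : ∀ x, 0 < q ^ x := fun x => by positivity
  have := three_mul_pow_le_pow (x := 3 * k - 1) (y := 3 * k) hq (by omega)
  have := three_mul_pow_le_pow hq (middleExponent_lt hk l)
  have := three_mul_pow_le_pow hq (lastExponent_lt_middleExponent hk hl10)
  have := h0 (lastExponent k l)
  unfold complementLeader
  split_ifs <;> omega

theorem exists_eq_complementLeader {q k t : ℕ} (hq : 3 ≤ q) (hqo : Odd q) (hk : 3 ≤ k)
    (hto : Odd t) (hmax : ∀ i, 0 < i → i < 3 * k → rotate q (3 * k) i t ≤ t)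
    (ht : t ≤ complementLeader q k 10) :
    ∃ l, 1 ≤ l ∧ l ≤ 10 ∧ t = complementLeader q k l := by
  have ht' : t ≤ q ^ (3 * k - 1) + q ^ (2 * k + 1) + q ^ (k + 2) := by
    simpa [complementLeader, middleExponent, lastExponent] using ht
  have of_exponents : ∀ a b l, t = q ^ (3 * k - 1) + q ^ a + q ^ b → 2 ≤ l → l ≤ 10 →
      middleExponent k l = a → lastExponent k l = b →
      ∃ l, 1 ≤ l ∧ l ≤ 10 ∧ t = complementLeader q k l := by
    rintro a b l h h1 h2 rfl rfl
    exact ⟨l, by omega, h2, by rw [complementLeader, if_neg (by omega), h]⟩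
  rcases odd_of_rotate_le_cases hq hqo hk hto hmax ht' with h | ⟨a, b, h, hab⟩
  · exact ⟨1, le_rfl, by omega, by simpa [complementLeader] using h⟩
  · rcases hab with ⟨ha, hb⟩ | ⟨ha, hb, hb'⟩ | ⟨ha, hb, hb'⟩
    · refine of_exponents a b 2 h ?_ ?_ ?_ ?_ <;> simp [middleExponent, lastExponent, *]
    · refine of_exponents a b (b + 4 - k) h (by omega) (by omega) ?_ ?_ <;>
      · simp only [middleExponent, lastExponent]
        split_ifs <;> omega
    · refine of_exponents a b (b + 8 - k) h (by omega) (by omega) ?_ ?_ <;>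
      · simp only [middleExponent, lastExponent]
        split_ifs <;> omega

theorem mem_oddLeaders_iff {q k s : ℕ} (hq : 3 ≤ q) (hqo : Odd q) (hk : 3 ≤ k) :
    s ∈ oddLeaders q (q ^ (3 * k) - 1) ↔
      ∃ t, s = q ^ (3 * k) - 1 - t ∧ 0 < t ∧ t < q ^ (3 * k) - 1 ∧ Odd t ∧
        ∀ i, 0 < i → i < 3 * k → rotate q (3 * k) i t ≤ t := by
  have hN : q ^ (3 * k) % 2 = 1 := Nat.odd_iff.1 hqo.pow
  simp only [oddLeaders, Finset.mem_filter, Finset.mem_range, Nat.odd_iff]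
  constructor
  · rintro ⟨h1, h2, h3⟩
    have e : s = q ^ (3 * k) - 1 - (q ^ (3 * k) - 1 - s) := by omega
    refine ⟨q ^ (3 * k) - 1 - s, e, by omega, by omega, by omega, ?_⟩
    rw [e] at h3
    exact (complement_leader_iff (by omega) (by omega) (by omega) (by omega)).1 h3
  · rintro ⟨t, rfl, h1, h2, h3, h4⟩
    exact ⟨by omega, by omega, (complement_leader_iff (by omega) (by omega) h1 h2).2 h4⟩

theorem isIthLargest_oddLeaders {q k l : ℕ} (hq : 3 ≤ q) (hqo : Odd q) (hk : 3 ≤ k) (hl : 1 ≤ l)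
    (hl10 : l ≤ 10) :
    IsIthLargest (oddLeaders q (q ^ (3 * k) - 1)) l
      (q ^ (3 * k) - 1 - complementLeader q k l) := by
  have hmem : ∀ j, 1 ≤ j → j ≤ 10 →
      q ^ (3 * k) - 1 - complementLeader q k j ∈ oddLeaders q (q ^ (3 * k) - 1) := by
    intro j hj hj10
    have hodd := odd_complementLeader hqo k j
    exact (mem_oddLeaders_iff hq hqo hk).2 ⟨_, rfl, hodd.pos, complementLeader_lt_pow hq hk hj10,
      hodd, fun i => rotate_complementLeader_le hq hk hj hj10⟩
  refine ⟨hmem l hl hl10, ?_⟩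
  have himg : (oddLeaders q (q ^ (3 * k) - 1)).filter
        (fun y => q ^ (3 * k) - 1 - complementLeader q k l ≤ y) =
      (Finset.Icc 1 l).image fun j => q ^ (3 * k) - 1 - complementLeader q k j := by
    ext s
    simp only [Finset.mem_filter, Finset.mem_image, Finset.mem_Icc]
    constructor
    · rintro ⟨h1, h2⟩
      obtain ⟨t, rfl, h3, h4, h5, h6⟩ := (mem_oddLeaders_iff hq hqo hk).1 h1
      have := complementLeader_lt_pow hq hk hl10
      have htl : t ≤ complementLeader q k l := by omega
      have hl' := (complementLeader_le_iff hq hk hl hl10 (by omega) le_rfl).2 hl10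
      obtain ⟨j, hj1, hj10, rfl⟩ := exists_eq_complementLeader hq hqo hk h5 h6 (htl.trans hl')
      exact ⟨j, ⟨hj1, (complementLeader_le_iff hq hk hj1 hj10 hl hl10).1 htl⟩, rfl⟩
    · rintro ⟨j, ⟨hj1, hjl⟩, rfl⟩
      have := (complementLeader_le_iff hq hk hj1 (by omega) hl hl10).2 hjl
      exact ⟨hmem j hj1 (by omega), by omega⟩
  rw [himg, Finset.card_image_of_injOn, Nat.card_Icc, Nat.add_sub_cancel]
  intro x hx y hy hxy
  simp only [Finset.coe_Icc, Set.mem_Icc] at hx hy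
  have := complementLeader_lt_pow (l := x) hq hk (by omega)
  have := complementLeader_lt_pow (l := y) hq hk (by omega)
  have hxy' : complementLeader q k x = complementLeader q k y := by
    simp only at hxy
    omega
  apply le_antisymm
  · exact (complementLeader_le_iff hq hk hx.1 (by omega) hy.1 (by omega)).1 hxy'.le
  · exact (complementLeader_le_iff hq hk hy.1 (by omega) hx.1 (by omega)).1 hxy'.ge

theorem stmt_7 (q m n : ℕ)
    (hq : ∃ p e : ℕ, p.Prime ∧ Odd p ∧ 0 < e ∧ q = p ^ e)
    (hq3 : 3 ≤ q) (hm : 9 ≤ m) (hm3 : m % 3 = 0) (hn : 2 * n = q ^ m - 1) :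
    ∀ i, 2 ≤ i → i ≤ 10 →
      (IsIthLargest (oddLeaders q (2 * n)) i
        (q ^ m - q ^ (m - 1) -
          q ^ (if i = 2 then 2 * m / 3 - 1 else if i ≤ 5 then 2 * m / 3 else 2 * m / 3 + 1) -
          q ^ (if i ≤ 3 then m / 3 - 1 else if i ≤ 5 then m / 3 + i - 4
               else m / 3 + i - 8) - 1) ∧
      (4 ≤ i →
        (qCoset q (2 * n)
          (q ^ m - q ^ (m - 1) -
          q ^ (if i = 2 then 2 * m / 3 - 1 else if i ≤ 5 then 2 * m / 3 else 2 * m / 3 + 1) -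
          q ^ (if i ≤ 3 then m / 3 - 1 else if i ≤ 5 then m / 3 + i - 4
               else m / 3 + i - 8) - 1)).ncard = m)) := by
  obtain ⟨p, e, -, hp, -, rfl⟩ := hq
  obtain ⟨k, rfl⟩ : ∃ k, m = 3 * k := ⟨m / 3, by omega⟩
  have hqo : Odd (p ^ e) := hp.pow
  generalize p ^ e = q at *
  have hk : 3 ≤ k := by omega
  intro i hi2 hi10
  have hs : q ^ (3 * k) - q ^ (3 * k - 1) -
      q ^ (if i = 2 then 2 * (3 * k) / 3 - 1 else if i ≤ 5 then 2 * (3 * k) / 3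
        else 2 * (3 * k) / 3 + 1) -
      q ^ (if i ≤ 3 then 3 * k / 3 - 1 else if i ≤ 5 then 3 * k / 3 + i - 4
        else 3 * k / 3 + i - 8) - 1 = q ^ (3 * k) - 1 - complementLeader q k i := by
    rw [show 2 * (3 * k) / 3 = 2 * k by omega, show 3 * k / 3 = k by omega, complementLeader,
      if_neg (by omega : i ≠ 1), middleExponent, lastExponent]
    omega
  rw [hs, hn]
  exact ⟨isIthLargest_oddLeaders hq3 hqo hk (by omega) hi10, fun hi4 =>
    ncard_qCoset_complement (by omega) (by omega) (odd_complementLeader hqo k i).pos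
      (complementLeader_lt_pow hq3 hk hi10)
      fun j => rotate_complementLeader_lt hq3 hk (by omega) hi10⟩
end
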